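/- arXiv:1806.06186 — 2 statements merged into one kernel-verified Lean document; each statement's English description precedes it below -/
import Mathlib

section
/- Let (X,d) be a nonempty compact metric space, f : X → X a continuous, open, distance expanding, topologically transitive map, and φ : X → ℝ Hölder continuous. Then the φ-conformal probability measure is unique: there is exactly one pair (λ, m) with λ > 0 and m a Borel probability measure on X such that m(f(Y)) = λ·∫_Y e^{−φ} dm for every Borel set Y ⊆ X on which f is injective. In particular, if (λ₁, m₁) and (λ₂, m₂) are two such pairs then λ₁ = λ₂ and m₁ = m₂. -/
open MeasureTheory Filter Metric Set

/-- `f` is distance expanding: there are `lam > 1` and `η > 0` with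
`dist (f x) (f y) ≥ lam * dist x y` whenever `dist x y ≤ η`. -/
def DistanceExpanding {X : Type*} [MetricSpace X] (f : X → X) : Prop :=
  ∃ lam > (1 : ℝ), ∃ η > (0 : ℝ), ∀ x y : X, dist x y ≤ η →
    lam * dist x y ≤ dist (f x) (f y)

/-- `f` is topologically transitive: for all nonempty open `U, V` there is
`n ≥ 0` with `f^[n] '' U ∩ V ≠ ∅`. -/
def TopologicallyTransitive {X : Type*} [TopologicalSpace X] (f : X → X) : Prop :=
  ∀ U V : Set X, IsOpen U → IsOpen V → U.Nonempty → V.Nonempty →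
    ∃ n : ℕ, (f^[n] '' U ∩ V).Nonempty

/-- `φ` is Hölder continuous: `|φ x - φ y| ≤ C * dist x y ^ b` for some
`C > 0` and `b ∈ (0, 1]`. -/
def HolderPotential {X : Type*} [MetricSpace X] (φ : X → ℝ) : Prop :=
  ∃ C > (0 : ℝ), ∃ b ∈ Set.Ioc (0 : ℝ) 1, ∀ x y : X, |φ x - φ y| ≤ C * dist x y ^ b

/-- Birkhoff sum `S_n φ (x) = ∑_{j<n} φ (f^j x)`. -/
def birkhoffSum' {X : Type*} (f : X → X) (φ : X → ℝ) (n : ℕ) (x : X) : ℝ :=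
  ∑ j ∈ Finset.range n, φ (f^[j] x)

/-- The Bowen ball `B_n(x, r) = {y : dist (f^j x) (f^j y) < r for all 0 ≤ j ≤ n}`. -/
def bowenBall {X : Type*} [MetricSpace X] (f : X → X) (n : ℕ) (x : X) (r : ℝ) : Set X :=
  {y | ∀ j ≤ n, dist (f^[j] x) (f^[j] y) < r}

/-- The `n`-th level tree sum `∑_{x ∈ f^{-n}(x₀)} exp (S_n φ (x))`
(a `tsum` over the fiber, which is finite in the situations considered). -/
noncomputable def treeSum {X : Type*} (f : X → X) (φ : X → ℝ) (n : ℕ) (x₀ : X) : ℝ :=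
  ∑' x : (f^[n] ⁻¹' {x₀} : Set X), Real.exp (birkhoffSum' f φ n x)


theorem aux_open {X : Type*} [MetricSpace X] [CompactSpace X] (f : X → X) (hf : Continuous f)
    (hopen : IsOpenMap f) (r : ℝ) (hr : 0 < r) :
    ∃ δ > 0, ∀ u y, dist (f u) y ≤ δ → ∃ v, f v = y ∧ dist u v < r := by
  have h1 : ∀ u : X, ∃ d > 0, ball (f u) d ⊆ f '' ball u (r/2) := by
    intro u
    have := (hopen _ (isOpen_ball (x := u) (ε := r/2)))
    exact Metric.isOpen_iff.1 this (f u) ⟨u, mem_ball_self (by positivity), rfl⟩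
  choose d hd hd2 using h1
  let U : X → Set X := fun u => ball u (r/2) ∩ f ⁻¹' (ball (f u) (d u / 2))
  have hU : ∀ u ∈ (univ : Set X), U u ∈ nhds u := by
    intro u _
    apply IsOpen.mem_nhds (isOpen_ball.inter (isOpen_ball.preimage hf))
    exact ⟨mem_ball_self (by positivity), mem_ball_self (by have := hd u; positivity)⟩
  obtain ⟨t, -, ht⟩ := isCompact_univ.elim_nhds_subcover U hU
  have h2 : ∃ δ > 0, ∀ u ∈ t, δ < d u / 2 := by
    clear ht
    classical
    induction t using Finset.induction_on with
    | empty => exact ⟨1, one_pos, by simp⟩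
    | insert a s _ ih =>
      obtain ⟨δ, h0, h⟩ := ih
      refine ⟨min δ (d a / 4), lt_min h0 (by have := hd a; positivity), ?_⟩
      intro u hu
      rcases Finset.mem_insert.1 hu with rfl | hu
      · have := hd u
        exact (min_le_right _ _).trans_lt (by linarith)
      · exact (min_le_left _ _).trans_lt (h u hu)
  obtain ⟨δ, h0, h⟩ := h2
  refine ⟨δ, h0, fun u y huy => ?_⟩
  have := ht (mem_univ u)
  simp only [mem_iUnion] at this
  obtain ⟨c, hc, hu1, hu2⟩ := this
  simp only [mem_ball, mem_preimage] at hu1 hu2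
  obtain ⟨v, hv, rfl⟩ := hd2 c (show y ∈ ball (f c) (d c) by
    rw [mem_ball]
    have := h c hc
    have := dist_triangle y (f u) (f c)
    rw [dist_comm y (f u)] at this
    linarith)
  refine ⟨v, rfl, ?_⟩
  rw [mem_ball] at hv
  have := dist_triangle u c v
  rw [dist_comm c v] at this
  linarith

theorem aux_fiber {X : Type*} [MetricSpace X] [CompactSpace X] (f : X → X) (hf : Continuous f)
    (η : ℝ) (hη : 0 < η) (hinj : ∀ x y, dist x y ≤ η → f x = f y → x = y) (x : X) :
    (f ⁻¹' {x}).Finite := by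
  have hc : IsCompact (f ⁻¹' {x}) := (isClosed_singleton.preimage hf).isCompact
  obtain ⟨t, ht, hcov⟩ := hc.elim_nhds_subcover (fun u => ball u η) (fun u _ => ball_mem_nhds u hη)
  refine t.finite_toSet.subset ?_
  intro u hu
  have := hcov hu
  simp only [mem_iUnion] at this
  obtain ⟨c, hc, hu1⟩ := this
  have : u = c := hinj _ _ (mem_ball.1 hu1).le (by rw [show f u = x from hu, show f c = x from ht c hc])
  rw [this]; exact hc

theorem aux_pair {X : Type*} [MetricSpace X] [CompactSpace X] (f : X → X) (hf : Continuous f)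
    (hopen : IsOpenMap f) (hexp : DistanceExpanding f) :
    ∃ F : X → Finset X, (∀ x u, u ∈ F x ↔ f u = x) ∧ ∃ κ : ℝ, 0 < κ ∧ κ < 1 ∧ ∃ δ > 0,
      ∀ x y, dist x y ≤ δ → ∃ σ : X → X, BijOn σ (F x) (F y) ∧
        ∀ u ∈ F x, dist u (σ u) ≤ κ * dist x y := by
  obtain ⟨lam, hl, η, hη, h⟩ := hexp
  have hinj : ∀ x y, dist x y ≤ η → f x = f y → x = y := by
    intro x y hxy he
    have := h x y hxy
    rw [he, dist_self] at this
    have h3 : dist x y ≤ 0 := by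
      by_contra hh
      push Not at hh
      nlinarith
    exact dist_le_zero.1 h3
  have hfin := aux_fiber f hf η hη hinj
  obtain ⟨δ, hδ, ho⟩ := aux_open f hf hopen (η/2) (by positivity)
  refine ⟨fun x => (hfin x).toFinset, by simp, lam⁻¹, by positivity, inv_lt_one_of_one_lt₀ hl, δ, hδ, ?_⟩
  intro x y hxy
  have h1 : ∀ u, ∃ v, f u = x → f v = y ∧ dist u v < η/2 := by
    intro u
    by_cases hu : f u = x
    · obtain ⟨v, hv⟩ := ho u y (by rw [hu]; exact hxy)
      exact ⟨v, fun _ => hv⟩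
    · exact ⟨u, fun h => absurd h hu⟩
  choose σ hσ using h1
  refine ⟨σ, ⟨?_, ?_, ?_⟩, ?_⟩
  · intro u hu
    simp at hu ⊢
    exact (hσ u hu).1
  · intro u hu v hv huv
    simp at hu hv
    apply hinj u v _ (hu.trans hv.symm)
    have h1 := (hσ u hu).2
    have h2 := (hσ v hv).2
    rw [← huv] at h2
    have := dist_triangle_right u v (σ u)
    linarith
  · intro v hv
    simp at hv
    obtain ⟨u, hu, huv⟩ := ho v x (by rw [hv, dist_comm]; exact hxy)
    refine ⟨u, by simpa using hu, ?_⟩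
    apply hinj _ _ _ ((hσ u hu).1.trans hv.symm)
    have h1 := (hσ u hu).2
    have := dist_triangle_left (σ u) v u
    rw [dist_comm v] at huv
    linarith
  · intro u hu
    simp at hu
    obtain ⟨h1, h2⟩ := hσ u hu
    have := h u (σ u) (by linarith)
    rw [hu, h1] at this
    rw [inv_mul_eq_div, le_div_iff₀ (by linarith)]
    linarith

theorem aux_op {X : Type*} [MetricSpace X] [CompactSpace X] (φ : X → ℝ) (hφ : Continuous φ)
    (F : X → Finset X) (κ : ℝ) (hκ : 0 < κ) (hκ1 : κ < 1) (δ : ℝ) (hδ : 0 < δ)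
    (hp : ∀ x y, dist x y ≤ δ → ∃ σ : X → X, BijOn σ (F x) (F y) ∧
        ∀ u ∈ F x, dist u (σ u) ≤ κ * dist x y) :
    ∃ L : C(X, ℝ) →ₗ[ℝ] C(X, ℝ), ∀ g x, L g x = ∑ u ∈ F x, Real.exp (φ u) * g u := by
  have hcont : ∀ w : X → ℝ, Continuous w → Continuous (fun x => ∑ u ∈ F x, w u) := by
    intro w hw
    have huc := CompactSpace.uniformContinuous_of_continuous hw
    rw [Metric.continuous_iff]
    intro x ε hε
    obtain ⟨r, hr, h⟩ := Metric.uniformContinuous_iff.1 huc (ε / (2 * ((F x).card + 1))) (by positivity)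
    refine ⟨min δ r, lt_min hδ hr, fun y hy => ?_⟩
    rw [dist_comm] at hy
    obtain ⟨σ, hσ, hd⟩ := hp x y (hy.le.trans (min_le_left _ _))
    have : ∑ u ∈ F y, w u = ∑ u ∈ F x, w (σ u) :=
      (Finset.sum_nbij σ hσ.mapsTo hσ.injOn hσ.surjOn (fun _ _ => rfl)).symm
    rw [this, Real.dist_eq, ← Finset.sum_sub_distrib]
    calc |∑ u ∈ F x, (w (σ u) - w u)| ≤ ∑ u ∈ F x, |w (σ u) - w u| := Finset.abs_sum_le_sum_abs _ _
      _ ≤ ∑ u ∈ F x, ε / (2 * ((F x).card + 1)) := by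
        apply Finset.sum_le_sum
        intro u hu
        rw [← Real.dist_eq, dist_comm]
        apply le_of_lt
        apply h
        have := hd u hu
        have h3 := hy.trans_le (min_le_right _ _)
        nlinarith [dist_nonneg (x := x) (y := y)]
      _ = ((F x).card : ℝ) / ((F x).card + 1) * (ε / 2) := by
        rw [Finset.sum_const, nsmul_eq_mul]; field_simp
      _ ≤ 1 * (ε / 2) := by
        gcongr
        rw [div_le_one (by positivity)]; linarith
      _ < ε := by linarith
  refine ⟨{ toFun := fun g => ⟨fun x => ∑ u ∈ F x, Real.exp (φ u) * g u, hcont _ (by fun_prop)⟩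
            map_add' := ?_, map_smul' := ?_ }, fun g x => rfl⟩
  · intro g h; ext x; simp [mul_add, Finset.sum_add_distrib]
  · intro c h; ext x; simp [Finset.mul_sum, mul_left_comm]

theorem aux_cont {X : Type*} [MetricSpace X] (φ : X → ℝ) (C b : ℝ) (hb : 0 < b)
    (h : ∀ x y : X, |φ x - φ y| ≤ C * dist x y ^ b) : Continuous φ := by
  rw [continuous_iff_continuousAt]
  intro x
  rw [ContinuousAt, tendsto_iff_dist_tendsto_zero]
  have h1 : Tendsto (fun y => C * dist y x ^ b) (nhds x) (nhds 0) := by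
    have : Continuous (fun y => C * dist y x ^ b) := by
      apply Continuous.mul continuous_const
      exact (continuous_id.dist continuous_const).rpow_const (fun _ => Or.inr hb.le)
    have := this.tendsto x
    simpa [Real.zero_rpow hb.ne'] using this
  exact squeeze_zero (fun _ => dist_nonneg) (fun y => by rw [Real.dist_eq]; exact h y x) h1

/-- distortion -/
theorem aux_dist {X : Type*} [MetricSpace X] [CompactSpace X] (φ : X → ℝ)
    (F : X → Finset X) (κ : ℝ) (hκ : 0 < κ) (hκ1 : κ < 1) (δ : ℝ) (hδ : 0 < δ)
    (hp : ∀ x y, dist x y ≤ δ → ∃ σ : X → X, BijOn σ (F x) (F y) ∧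
        ∀ u ∈ F x, dist u (σ u) ≤ κ * dist x y)
    (C b : ℝ) (hC : 0 < C) (hb : 0 < b)
    (h : ∀ x y : X, |φ x - φ y| ≤ C * dist x y ^ b)
    (L : C(X, ℝ) →ₗ[ℝ] C(X, ℝ)) (hL : ∀ g x, L g x = ∑ u ∈ F x, Real.exp (φ u) * g u) :
    ∃ K > 0, ∀ g : C(X, ℝ), (∀ x, 0 < g x) → ∃ n0 : ℕ, ∀ n ≥ n0, ∀ x y, dist x y ≤ δ →
      (L ^ n) g x ≤ K * (L ^ n) g y := by
  set q := κ ^ b with hq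
  have hq1 : q < 1 := Real.rpow_lt_one hκ.le hκ1 hb
  have hq0 : 0 < q := Real.rpow_pos_of_pos hκ b
  set A := C * q / (1 - q) with hA
  have h1q : 0 < 1 - q := by linarith
  have hA0 : 0 < A := by positivity
  have hAq : (C + A) * q = A := by rw [hA]; field_simp; ring
  have hpos : ∀ g : C(X, ℝ), (∀ x, 0 ≤ g x) → ∀ n x, 0 ≤ (L ^ n) g x := by
    intro g hg n
    induction n with
    | zero => simpa using hg
    | succ n ih =>
      intro x
      rw [pow_succ', Module.End.mul_apply, hL]
      exact Finset.sum_nonneg fun u _ => mul_nonneg (Real.exp_pos _).le (ih u)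
  refine ⟨2 * Real.exp (A * δ ^ b), by positivity, fun g hg => ?_⟩
  -- initial scale
  have hinit : ∃ r > 0, ∀ x y, dist x y ≤ r → g x ≤ 2 * g y := by
    have huc : UniformContinuous (fun x => Real.log (g x)) :=
      CompactSpace.uniformContinuous_of_continuous
        (Continuous.log g.continuous (fun x => (hg x).ne'))
    obtain ⟨r, hr, hh⟩ := Metric.uniformContinuous_iff.1 huc (Real.log 2) (Real.log_pos (by norm_num))
    refine ⟨r/2, by positivity, fun x y hxy => ?_⟩
    have := hh (show dist x y < r by linarith)
    rw [Real.dist_eq] at this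
    have := (abs_lt.1 this).2
    rw [← Real.log_le_log_iff (hg x) (by have := hg y; positivity), Real.log_mul (by norm_num) (hg y).ne']
    linarith
  obtain ⟨r, hr, hinit⟩ := hinit
  have key : ∀ n : ℕ, ∀ x y, dist x y ≤ δ → κ ^ n * dist x y ≤ r →
      (L ^ n) g x ≤ 2 * Real.exp (A * dist x y ^ b) * (L ^ n) g y := by
    intro n
    induction n with
    | zero =>
      intro x y _ hxy
      have h1 := hinit x y (by simpa using hxy)
      have h2 : 1 ≤ Real.exp (A * dist x y ^ b) := Real.one_le_exp (by positivity)
      have := hg y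
      simp only [pow_zero, Module.End.one_apply]
      nlinarith
    | succ n ih =>
      intro x y hd hxy
      obtain ⟨σ, hσ, hs⟩ := hp x y hd
      rw [pow_succ', Module.End.mul_apply, hL, hL]
      have : ∑ u ∈ F y, Real.exp (φ u) * (L ^ n) g u = ∑ u ∈ F x, Real.exp (φ (σ u)) * (L ^ n) g (σ u) :=
        (Finset.sum_nbij σ hσ.mapsTo hσ.injOn hσ.surjOn (fun _ _ => rfl)).symm
      rw [this, Finset.mul_sum]
      apply Finset.sum_le_sum
      intro u hu
      have hsu := hs u hu
      have hdn : 0 ≤ dist x y := dist_nonneg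
      have h1 := ih u (σ u) (by nlinarith) (by
        calc κ ^ n * dist u (σ u) ≤ κ ^ n * (κ * dist x y) := by gcongr
          _ = κ ^ (n+1) * dist x y := by ring
          _ ≤ r := hxy)
      have h2 : dist u (σ u) ^ b ≤ q * dist x y ^ b := by
        rw [hq, ← Real.mul_rpow hκ.le hdn]
        exact Real.rpow_le_rpow dist_nonneg hsu hb.le
      have h3 : φ u ≤ φ (σ u) + C * dist u (σ u) ^ b := by
        have := (abs_le.1 (h u (σ u))).2
        linarith
      have h4 := hpos g (fun x => (hg x).le) n (σ u)
      calc Real.exp (φ u) * (L ^ n) g u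
          ≤ Real.exp (φ (σ u) + C * dist u (σ u) ^ b) *
            (2 * Real.exp (A * dist u (σ u) ^ b) * (L ^ n) g (σ u)) := by
            gcongr
            exact hpos g (fun x => (hg x).le) n u
        _ = 2 * Real.exp ((C + A) * dist u (σ u) ^ b) * (Real.exp (φ (σ u)) * (L ^ n) g (σ u)) := by
            rw [Real.exp_add, add_mul, Real.exp_add]; ring
        _ ≤ 2 * Real.exp (A * dist x y ^ b) * (Real.exp (φ (σ u)) * (L ^ n) g (σ u)) := by
            refine mul_le_mul_of_nonneg_right (mul_le_mul_of_nonneg_left (Real.exp_le_exp.2 ?_) (by norm_num)) (by positivity)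
            calc (C + A) * dist u (σ u) ^ b ≤ (C + A) * (q * dist x y ^ b) := by gcongr
              _ = A * dist x y ^ b := by rw [← mul_assoc, hAq]
  obtain ⟨n0, hn0⟩ := exists_pow_lt_of_lt_one (show 0 < r / δ by positivity) hκ1
  refine ⟨n0, fun n hn x y hxy => ?_⟩
  have h4 := hpos g (fun x => (hg x).le) n y
  refine (key n x y hxy ?_).trans ?_
  · calc κ ^ n * dist x y ≤ κ ^ n0 * δ := by
          apply mul_le_mul (pow_le_pow_of_le_one hκ.le hκ1.le hn) hxy dist_nonneg (by positivity)
      _ ≤ r / δ * δ := by gcongr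
      _ = r := by field_simp
  · gcongr


theorem aux_surj {X : Type*} [MetricSpace X] [CompactSpace X] [Nonempty X] (f : X → X)
    (hf : Continuous f) (hopen : IsOpenMap f) (htrans : TopologicallyTransitive f) :
    Function.Surjective f := by
  by_contra hns
  have hcl : IsClosed (range f) := (isCompact_range hf).isClosed
  have hne : ((range f)ᶜ).Nonempty := by
    rw [Set.nonempty_compl]
    intro h
    exact hns (range_eq_univ.1 h)
  obtain ⟨n, z, ⟨u, hu, rfl⟩, hz⟩ := htrans (range f) (range f)ᶜ hopen.isOpen_range hcl.isOpen_compl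
    (range_nonempty f) hne
  apply hz
  cases n with
  | zero => simpa using hu
  | succ n => rw [Function.iterate_succ_apply']; exact mem_range_self _

/-- uniform transitivity -/
theorem aux_trans {X : Type*} [MetricSpace X] [CompactSpace X] (f : X → X)
    (htrans : TopologicallyTransitive f) (δ : ℝ) (hδ : 0 < δ) :
    ∃ N : ℕ, ∀ x y, ∃ k ≤ N, ∃ u, dist x u ≤ δ ∧ dist (f^[k] u) y ≤ δ := by
  obtain ⟨t, -, ht⟩ := isCompact_univ.elim_nhds_subcover (fun u : X => ball u (δ/2))
    (fun u _ => ball_mem_nhds u (by positivity))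
  have h1 : ∀ a c : X, ∃ n : ℕ, (f^[n] '' (ball a (δ/2)) ∩ ball c (δ/2)).Nonempty := fun a c =>
    htrans _ _ isOpen_ball isOpen_ball ⟨a, mem_ball_self (by positivity)⟩
      ⟨c, mem_ball_self (by positivity)⟩
  choose k hk using h1
  refine ⟨(t ×ˢ t).sup (fun p => k p.1 p.2), fun x y => ?_⟩
  have hx := ht (mem_univ x)
  have hy := ht (mem_univ y)
  simp only [mem_iUnion] at hx hy
  obtain ⟨a, ha, hxa⟩ := hx
  obtain ⟨c, hc, hyc⟩ := hy
  obtain ⟨z, ⟨u, hu, rfl⟩, hz⟩ := hk a c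
  refine ⟨k a c, Finset.le_sup (f := fun p : X × X => k p.1 p.2) (Finset.mk_mem_product ha hc), u, ?_, ?_⟩
  · rw [mem_ball] at hxa hu
    have := dist_triangle_right x u a
    linarith
  · rw [mem_ball] at hyc hz
    have := dist_triangle_right (f^[k a c] u) y c
    linarith

theorem aux_pos {X : Type*} [MetricSpace X] [CompactSpace X] (φ : X → ℝ)
    (F : X → Finset X)
    (L : C(X, ℝ) →ₗ[ℝ] C(X, ℝ)) (hL : ∀ g x, L g x = ∑ u ∈ F x, Real.exp (φ u) * g u) :
    ∀ g : C(X, ℝ), (∀ x, 0 ≤ g x) → ∀ n x, 0 ≤ (L ^ n) g x := by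
  intro g hg n
  induction n with
  | zero => simpa using hg
  | succ n ih =>
    intro x
    rw [pow_succ', Module.End.mul_apply, hL]
    exact Finset.sum_nonneg fun u _ => mul_nonneg (Real.exp_pos _).le (ih u)

/-- comparison of iterates at all pairs of points -/
theorem aux_comp {X : Type*} [MetricSpace X] [CompactSpace X] (f : X → X) (φ : X → ℝ)
    (hφ : Continuous φ)
    (htrans : TopologicallyTransitive f)
    (F : X → Finset X) (hF : ∀ x u, u ∈ F x ↔ f u = x) (δ : ℝ) (hδ : 0 < δ)
    (L : C(X, ℝ) →ₗ[ℝ] C(X, ℝ)) (hL : ∀ g x, L g x = ∑ u ∈ F x, Real.exp (φ u) * g u)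
    (K : ℝ) (hK : 0 < K)
    (hd : ∀ g : C(X, ℝ), (∀ x, 0 < g x) → ∃ n0 : ℕ, ∀ n ≥ n0, ∀ x y, dist x y ≤ δ →
      (L ^ n) g x ≤ K * (L ^ n) g y) :
    ∃ D > 0, ∃ N : ℕ, ∀ g : C(X, ℝ), (∀ x, 0 < g x) → ∃ n0 : ℕ, ∀ n ≥ n0, ∀ x y,
      (L ^ n) g x ≤ D * ∑ k ∈ Finset.range N, (L ^ (n + k)) g y := by
  obtain ⟨N, hN⟩ := aux_trans f htrans δ hδ
  obtain ⟨B, hB⟩ : ∃ B : ℝ, ∀ x, |φ x| ≤ B := by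
    obtain ⟨B, hB⟩ := isCompact_univ.exists_bound_of_continuousOn hφ.continuousOn
    exact ⟨B, fun x => hB x (mem_univ x)⟩
  have hstep : ∀ g : C(X, ℝ), (∀ x, 0 ≤ g x) → ∀ (n k : ℕ) (u : X),
      (L ^ n) g u ≤ Real.exp (|B| * k) * (L ^ (n + k)) g (f^[k] u) := by
    intro g hg n k u
    induction k with
    | zero => simp
    | succ k ih =>
      refine ih.trans ?_
      rw [Function.iterate_succ_apply', ← add_assoc, pow_succ' L (n + k), Module.End.mul_apply, hL]
      have h1 : Real.exp (φ (f^[k] u)) * (L ^ (n + k)) g (f^[k] u) ≤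
          ∑ v ∈ F (f (f^[k] u)), Real.exp (φ v) * (L ^ (n + k)) g v :=
        Finset.single_le_sum (f := fun v => Real.exp (φ v) * (L ^ (n + k)) g v)
          (fun v _ => mul_nonneg (Real.exp_pos _).le (aux_pos φ F L hL g hg _ v)) ((hF _ _).2 rfl)
      have h2 : 1 ≤ Real.exp |B| * Real.exp (φ (f^[k] u)) := by
        rw [← Real.exp_add]
        apply Real.one_le_exp
        have := (abs_le.1 (hB (f^[k] u))).1
        have := le_abs_self B
        linarith
      have h3 := aux_pos φ F L hL g hg (n + k) (f^[k] u)
      have h4 : Real.exp (|B| * (k + 1 : ℕ)) = Real.exp (|B| * k) * Real.exp |B| := by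
        rw [← Real.exp_add]; push_cast; ring_nf
      rw [h4, mul_assoc]
      gcongr
      calc (L ^ (n + k)) g (f^[k] u) ≤ (Real.exp |B| * Real.exp (φ (f^[k] u))) * (L ^ (n + k)) g (f^[k] u) :=
            le_mul_of_one_le_left h3 h2
        _ ≤ _ := by rw [mul_assoc]; gcongr
  refine ⟨K * Real.exp (|B| * N) * K, by positivity, N + 1, fun g hg => ?_⟩
  obtain ⟨n0, hn0⟩ := hd g hg
  refine ⟨n0, fun n hn x y => ?_⟩
  obtain ⟨k, hkN, u, hxu, huy⟩ := hN x y
  have hg0 : ∀ x, 0 ≤ g x := fun x => (hg x).le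
  have hk' : (k : ℝ) ≤ N := by exact_mod_cast hkN
  have p1 := aux_pos φ F L hL g hg0 (n + k) (f^[k] u)
  have p2 := aux_pos φ F L hL g hg0 (n + k) y
  calc (L ^ n) g x ≤ K * (L ^ n) g u := hn0 n hn x u hxu
    _ ≤ K * (Real.exp (|B| * k) * (L ^ (n + k)) g (f^[k] u)) := by gcongr; exact hstep g hg0 n k u
    _ ≤ K * (Real.exp (|B| * N) * (K * (L ^ (n + k)) g y)) := by
        gcongr
        exact hn0 (n + k) (by omega) _ _ huy
    _ = K * Real.exp (|B| * N) * K * (L ^ (n + k)) g y := by ring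
    _ ≤ _ := by
        gcongr
        exact Finset.single_le_sum (f := fun k => (L ^ (n + k)) g y)
          (fun v _ => aux_pos φ F L hL g hg0 _ y) (Finset.mem_range.2 (by omega))

/-- normalized positive eigenfunctional -/
structure EigF {X : Type*} [MetricSpace X] [CompactSpace X] (L : C(X, ℝ) →ₗ[ℝ] C(X, ℝ))
    (lam : ℝ) (ν : C(X, ℝ) →ₗ[ℝ] ℝ) : Prop where
  lpos : 0 < lam
  pos : ∀ g : C(X, ℝ), (∀ x, 0 ≤ g x) → 0 ≤ ν g
  one : ν 1 = 1
  eig : ∀ g, ν (L g) = lam * ν g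

section
variable {X : Type*} [MetricSpace X] [CompactSpace X] {L : C(X, ℝ) →ₗ[ℝ] C(X, ℝ)}

theorem EigF.pow {lam : ℝ} {ν : C(X, ℝ) →ₗ[ℝ] ℝ} (h : EigF L lam ν) (n : ℕ) (g : C(X, ℝ)) :
    ν ((L ^ n) g) = lam ^ n * ν g := by
  induction n with
  | zero => simp
  | succ n ih => rw [pow_succ', Module.End.mul_apply, h.eig, ih]; ring

theorem EigF.mono {lam : ℝ} {ν : C(X, ℝ) →ₗ[ℝ] ℝ} (h : EigF L lam ν) {g k : C(X, ℝ)}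
    (hgk : ∀ x, g x ≤ k x) : ν g ≤ ν k := by
  have := h.pos (k - g) (fun x => by simpa using hgk x)
  rw [map_sub] at this
  linarith

theorem EigF.const {lam : ℝ} {ν : C(X, ℝ) →ₗ[ℝ] ℝ} (h : EigF L lam ν) (c : ℝ) :
    ν (c • (1 : C(X, ℝ))) = c := by simp [h.one]

theorem EigF.compare (D : ℝ) (hD : 0 < D) (N : ℕ)
    (hc : ∀ g : C(X, ℝ), (∀ x, 0 < g x) → ∃ n0 : ℕ, ∀ n ≥ n0, ∀ x y,
      (L ^ n) g x ≤ D * ∑ k ∈ Finset.range N, (L ^ (n + k)) g y)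
    {lam₁ lam₂ : ℝ} {ν₁ ν₂ : C(X, ℝ) →ₗ[ℝ] ℝ} (h₁ : EigF L lam₁ ν₁) (h₂ : EigF L lam₂ ν₂)
    (g : C(X, ℝ)) (hg : ∀ x, 0 < g x) : ∃ n0 : ℕ, ∀ n ≥ n0,
      lam₁ ^ n * ν₁ g ≤ (D * ∑ k ∈ Finset.range N, lam₂ ^ k) * (lam₂ ^ n * ν₂ g) := by
  obtain ⟨n0, hn0⟩ := hc g hg
  refine ⟨n0, fun n hn => ?_⟩
  have h1 : ∀ y, lam₁ ^ n * ν₁ g ≤ D * ∑ k ∈ Finset.range N, (L ^ (n + k)) g y := by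
    intro y
    rw [← h₁.pow, ← h₁.const (D * ∑ k ∈ Finset.range N, (L ^ (n + k)) g y)]
    apply h₁.mono
    intro x
    simpa using hn0 n hn x y
  have h2 := h₂.mono (g := (lam₁ ^ n * ν₁ g) • 1) (k := D • ∑ k ∈ Finset.range N, (L ^ (n + k)) g)
    (by intro y; simpa using h1 y)
  rw [h₂.const, map_smul, map_sum] at h2
  refine h2.trans_eq ?_
  simp only [h₂.pow, smul_eq_mul, mul_assoc]
  rw [Finset.sum_mul]
  congr 1
  apply Finset.sum_congr rfl
  intros; rw [pow_add]; ring

theorem EigF.lam_le (D : ℝ) (hD : 0 < D) (N : ℕ)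
    (hc : ∀ g : C(X, ℝ), (∀ x, 0 < g x) → ∃ n0 : ℕ, ∀ n ≥ n0, ∀ x y,
      (L ^ n) g x ≤ D * ∑ k ∈ Finset.range N, (L ^ (n + k)) g y)
    {lam₁ lam₂ : ℝ} {ν₁ ν₂ : C(X, ℝ) →ₗ[ℝ] ℝ} (h₁ : EigF L lam₁ ν₁) (h₂ : EigF L lam₂ ν₂) :
    lam₁ ≤ lam₂ := by
  obtain ⟨n0, hn⟩ := EigF.compare D hD N hc h₁ h₂ 1 (by simp)
  by_contra hlt
  push Not at hlt
  have p2 := h₂.lpos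
  have h1 : 1 < lam₁ / lam₂ := (one_lt_div p2).2 hlt
  have := tendsto_pow_atTop_atTop_of_one_lt h1
  obtain ⟨n, hn1, hn2⟩ := ((this.eventually_gt_atTop (D * ∑ k ∈ Finset.range N, lam₂ ^ k)).and
    (eventually_ge_atTop n0)).exists
  have := hn n hn2
  rw [h₁.one, h₂.one, mul_one, mul_one] at this
  rw [div_pow, lt_div_iff₀ (by positivity)] at hn1
  linarith

set_option maxHeartbeats 2000000 in
theorem EigF.unique (D : ℝ) (hD : 0 < D) (N : ℕ)
    (hc : ∀ g : C(X, ℝ), (∀ x, 0 < g x) → ∃ n0 : ℕ, ∀ n ≥ n0, ∀ x y,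
      (L ^ n) g x ≤ D * ∑ k ∈ Finset.range N, (L ^ (n + k)) g y)
    {lam : ℝ} {ν₁ ν₂ : C(X, ℝ) →ₗ[ℝ] ℝ} (h₁ : EigF L lam ν₁) (h₂ : EigF L lam ν₂) :
    ν₁ = ν₂ := by
  set E := D * ∑ k ∈ Finset.range N, lam ^ k with hE
  have hlp := h₁.lpos
  have hE0 : 0 ≤ E := by positivity
  -- comparison
  have hcmp : ∀ {ν ν' : C(X, ℝ) →ₗ[ℝ] ℝ}, EigF L lam ν → EigF L lam ν' →
      ∀ g : C(X, ℝ), (∀ x, 0 ≤ g x) → ν g ≤ E * ν' g := by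
    intro ν ν' h h' g hg
    have hp : ∀ ε > 0, ν g + ε ≤ E * (ν' g + ε) := by
      intro ε hε
      obtain ⟨n0, hn⟩ := EigF.compare D hD N hc h h' (g + ε • 1)
        (by intro x; have := hg x; simp; linarith)
      have := hn n0 le_rfl
      rw [map_add, map_add, h.const, h'.const, ← hE] at this
      have hp : 0 < lam ^ n0 := by positivity
      have h3 : lam ^ n0 * (ν g + ε) ≤ lam ^ n0 * (E * (ν' g + ε)) := by linarith
      exact le_of_mul_le_mul_left h3 hp
    apply le_of_forall_pos_le_add
    intro ε hε
    have := hp (ε / (E + 1)) (by positivity)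
    have h2 : 0 < ε / (E + 1) := by positivity
    have h3 : E * (ε / (E + 1)) ≤ ε := by
      rw [mul_div_assoc', div_le_iff₀ (by positivity)]; nlinarith
    nlinarith
  have hE1 : 1 ≤ E := by
    have := hcmp h₁ h₂ 1 (by simp)
    rwa [h₁.one, h₂.one, mul_one] at this
  set S : Set ℝ := {c | 0 ≤ c ∧ c ≤ 1 ∧ ∀ g : C(X, ℝ), (∀ x, 0 ≤ g x) → c * ν₁ g ≤ ν₂ g} with hS
  have hS0 : (0 : ℝ) ∈ S := ⟨le_rfl, zero_le_one, fun g hg => by simpa using h₂.pos g hg⟩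
  have hSb : BddAbove S := ⟨1, fun c hc => hc.2.1⟩
  have hScl : IsClosed S := by
    have : S = Icc 0 1 ∩ ⋂ g : C(X, ℝ), ⋂ _ : (∀ x, 0 ≤ g x), {c : ℝ | c * ν₁ g ≤ ν₂ g} := by
      ext c; simp [hS, and_assoc]
    rw [this]
    apply isClosed_Icc.inter
    refine isClosed_iInter fun g => isClosed_iInter fun _ => ?_
    exact isClosed_le (by fun_prop) continuous_const
  have hm := hScl.csSup_mem ⟨0, hS0⟩ hSb
  set c := sSup S with hcdef
  have hc1 : c = 1 := by
    by_contra hne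
    have hlt : c < 1 := lt_of_le_of_ne hm.2.1 hne
    have h1c : 0 < 1 - c := by linarith
    have h' : EigF L lam ((1 - c)⁻¹ • (ν₂ - c • ν₁)) := by
      refine ⟨hlp, fun g hg => ?_, ?_, fun g => ?_⟩
      · have := hm.2.2 g hg
        simp only [LinearMap.smul_apply, LinearMap.sub_apply, smul_eq_mul]
        apply mul_nonneg (by positivity)
        linarith
      · simp only [LinearMap.smul_apply, LinearMap.sub_apply, smul_eq_mul, h₁.one, h₂.one, mul_one]
        field_simp
      · simp only [LinearMap.smul_apply, LinearMap.sub_apply, smul_eq_mul, h₁.eig, h₂.eig]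
        ring
    have hmem : c + (1 - c) / E ∈ S := by
      refine ⟨?_, ?_, ?_⟩
      · have := hm.1; positivity
      · have : (1 - c) / E ≤ 1 - c := div_le_self h1c.le hE1
        linarith
      · intro g hg
        have := hcmp h₁ h' g hg
        simp only [LinearMap.smul_apply, LinearMap.sub_apply, smul_eq_mul] at this
        have e : (c + (1 - c) / E) * ν₁ g = c * ν₁ g + (1 - c) / E * ν₁ g := by ring
        rw [e]
        have h5 : (1 - c) / E * ν₁ g ≤ (1 - c) / E * (E * ((1 - c)⁻¹ * (ν₂ g - c * ν₁ g))) := by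
          gcongr
        have h6 : (1 - c) / E * (E * ((1 - c)⁻¹ * (ν₂ g - c * ν₁ g))) = ν₂ g - c * ν₁ g := by
          field_simp
        linarith
    have := le_csSup hSb hmem
    have : 0 < (1 - c) / E := by positivity
    linarith
  have hle : ∀ g : C(X, ℝ), (∀ x, 0 ≤ g x) → ν₁ g ≤ ν₂ g := by
    intro g hg
    have := hm.2.2 g hg
    rwa [hc1, one_mul] at this
  have hall : ∀ g : C(X, ℝ), ν₁ g ≤ ν₂ g := by
    intro g
    have := hle (g + ‖g‖ • 1) (fun x => by
      have := (abs_le.1 (g.norm_coe_le_norm x)).1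
      change 0 ≤ g x + ‖g‖ * 1
      linarith)
    rw [map_add, map_add, h₁.const, h₂.const] at this
    linarith
  ext g
  apply le_antisymm (hall g)
  have := hall (-g)
  rw [map_neg, map_neg] at this
  linarith
end


set_option maxHeartbeats 2000000 in
theorem aux_exists {X : Type*} [MetricSpace X] [CompactSpace X] [Nonempty X] 
    (L : C(X, ℝ) →ₗ[ℝ] C(X, ℝ))
    (hpos : ∀ g : C(X, ℝ), (∀ x, 0 ≤ g x) → ∀ n x, 0 ≤ (L ^ n) g x)
    (c : ℝ) (hc : 0 < c) (hc1 : ∀ x, c ≤ L 1 x) :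
    ∃ lam ν, EigF L lam ν := by
  have hmono : ∀ g k : C(X, ℝ), (∀ x, g x ≤ k x) → ∀ n x, (L ^ n) g x ≤ (L ^ n) k x := by
    intro g k h n x
    have := hpos (k - g) (fun x => by simpa using h x) n x
    rw [map_sub] at this
    simpa using this
  have hsm : ∀ (a : ℝ) (g : C(X, ℝ)) n x, (L ^ n) (a • g) x = a * (L ^ n) g x := by
    intro a g n x; rw [map_smul]; rfl
  have hsucc : ∀ (g : C(X, ℝ)) n, (L ^ (n+1)) g = (L ^ n) (L g) := by
    intro g n; rw [pow_succ, Module.End.mul_apply]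
  have hpow_le : ∀ (g : C(X, ℝ)) (s : ℝ), 0 ≤ s → (∀ x, L g x ≤ s * g x) →
      ∀ (n : ℕ) x, (L ^ n) g x ≤ s ^ n * g x := by
    intro g s hs h n
    induction n with
    | zero => intro x; simp
    | succ n ih =>
      intro x
      rw [hsucc]
      calc (L ^ n) (L g) x ≤ (L ^ n) (s • g) x := hmono _ _ (by intro x; simpa using h x) n x
        _ = s * (L ^ n) g x := hsm _ _ _ _
        _ ≤ s * (s ^ n * g x) := by gcongr; exact ih x
        _ = _ := by ring
  have hpow_ge : ∀ (n : ℕ) x, c ^ n ≤ (L ^ n) 1 x := by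
    intro n
    induction n with
    | zero => intro x; simp
    | succ n ih =>
      intro x
      rw [hsucc]
      calc c ^ (n+1) = c * c ^ n := by ring
        _ ≤ c * (L ^ n) 1 x := by gcongr; exact ih x
        _ = (L ^ n) (c • 1) x := (hsm _ _ _ _).symm
        _ ≤ _ := hmono _ _ (by intro x; simpa using hc1 x) n x
  have hbd : ∀ (g : C(X, ℝ)) x, |g x| ≤ ‖g‖ := fun g x => g.norm_coe_le_norm x
  set S : Set ℝ := {s | 0 < s ∧ ∃ K : ℝ, ∀ (n : ℕ) x, (L ^ n) 1 x ≤ K * s ^ n} with hS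
  have hSc : ∀ s ∈ S, c ≤ s := by
    rintro s ⟨hs, K, hK⟩
    by_contra hlt
    push Not at hlt
    obtain ⟨x⟩ := ‹Nonempty X›
    have := tendsto_pow_atTop_atTop_of_one_lt ((one_lt_div hs).2 hlt)
    obtain ⟨n, hn⟩ := (this.eventually_gt_atTop K).exists
    rw [div_pow, lt_div_iff₀ (by positivity)] at hn
    have := hK n x
    have := hpow_ge n x
    linarith
  have hSne : S.Nonempty := by
    have hL1 : c ≤ ‖L 1‖ := by
      obtain ⟨x⟩ := ‹Nonempty X›
      exact (hc1 x).trans ((le_abs_self _).trans (hbd _ x))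
    refine ⟨‖L 1‖, by linarith, 1, fun n x => ?_⟩
    have := hpow_le 1 ‖L 1‖ (norm_nonneg _) (fun x => by
      simpa using (le_abs_self _).trans (hbd (L 1) x)) n x
    simpa using this
  have hSbb : BddBelow S := ⟨c, hSc⟩
  set r := sInf S with hr
  have hrpos : 0 < r := lt_of_lt_of_le hc (le_csInf hSne hSc)
  -- maximum principle
  have hmax : ∀ s, r < s → ∀ k : C(X, ℝ), (∀ x, L k x ≤ s * k x) → ∀ x, 0 ≤ k x := by
    intro s hs k hk x
    obtain ⟨s', ⟨hs'0, K, hK⟩, hs'⟩ := exists_lt_of_csInf_lt hSne hs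
    have hs0 : 0 < s := hrpos.trans hs
    have h1 : ∀ n : ℕ, -(‖k‖ * K) * (s' / s) ^ n ≤ k x := by
      intro n
      have h2 := hpow_le k s hs0.le hk n x
      have h3 := hmono ((-‖k‖) • 1) k (by
        intro x
        have := (abs_le.1 (hbd k x)).1
        simpa using this) n x
      rw [hsm] at h3
      have h4 : ‖k‖ * (L ^ n) 1 x ≤ ‖k‖ * (K * s' ^ n) := by
        gcongr; exact hK n x
      rw [div_pow, mul_div_assoc', div_le_iff₀ (by positivity)]
      linarith
    have h2 : Tendsto (fun n : ℕ => -(‖k‖ * K) * (s' / s) ^ n) atTop (nhds 0) := by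
      have := tendsto_pow_atTop_nhds_zero_of_lt_one (r := s' / s) (by positivity)
        ((div_lt_one hs0).2 hs')
      simpa using this.const_mul (-(‖k‖ * K))
    exact le_of_tendsto h2 (Eventually.of_forall h1)
  -- no function with r k - L k > 0 everywhere
  have hno : ∀ k : C(X, ℝ), ¬ (∀ x, 0 < r * k x - L k x) := by
    intro k hk
    obtain ⟨x0, -, hx0⟩ := isCompact_univ.exists_isMinOn univ_nonempty
      (f := fun x => r * k x - L k x) (by fun_prop)
    set ε := r * k x0 - L k x0 with hε
    have hε0 : 0 < ε := hk x0
    have hmin : ∀ x, L k x ≤ r * k x - ε := by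
      intro x
      have : ε ≤ r * k x - L k x := hx0 (mem_univ x)
      linarith
    have hk0 : ∀ x, 0 ≤ k x := by
      apply hmax (r + ε / (‖k‖ + 1)) (by have : 0 < ε / (‖k‖ + 1) := (by positivity); linarith)
      intro x
      have h1 := hmin x
      have h2 := (abs_le.1 (hbd k x)).1
      have h3 : ε / (‖k‖ + 1) * k x ≥ -ε := by
        rw [ge_iff_le, div_mul_eq_mul_div, le_div_iff₀ (by positivity)]
        nlinarith
      linarith
    have hkge : ∀ x, ε / r ≤ k x := by
      intro x
      have h1 := hpos k hk0 1 x
      rw [pow_one] at h1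
      have := hmin x
      rw [div_le_iff₀ hrpos]
      linarith
    set K := ‖k‖ + ε / r + 1 with hK
    have hK0 : 0 < K := by positivity
    have hεK : ε / K < r := by
      rw [div_lt_iff₀ hK0]
      have : r * K = r * ‖k‖ + ε + r := by rw [hK]; field_simp
      have := norm_nonneg k
      nlinarith
    have hεK0 : 0 < ε / K := by positivity
    have hr' : ∀ x, L k x ≤ (r - ε / K) * k x := by
      intro x
      have h1 := hmin x
      have h2 : ε / K * k x ≤ ε := by
        rw [div_mul_eq_mul_div, div_le_iff₀ hK0]
        have := (abs_le.1 (hbd k x)).2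
        have : k x ≤ K := by
          have : 0 < ε / r := by positivity
          linarith
        gcongr
      linarith
    have hmem : r - ε / K ∈ S := by
      refine ⟨by linarith, r / ε * K, fun n x => ?_⟩
      have h1 := hmono 1 ((r / ε) • k) (by
        intro x
        have := hkge x
        have h3 : (r / ε) * (ε / r) ≤ r / ε * k x := by gcongr
        have h4 : (r / ε) * (ε / r) = 1 := by field_simp
        rw [h4] at h3
        simpa using h3) n x
      rw [hsm] at h1
      have h2 := hpow_le k (r - ε / K) (by linarith) hr' n x
      have h3 : k x ≤ K := by
        have := (abs_le.1 (hbd k x)).2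
        have : 0 < ε / r := by positivity
        linarith
      have h4 : 0 < r - ε / K := by linarith
      calc (L ^ n) 1 x ≤ r / ε * (L ^ n) k x := h1
        _ ≤ r / ε * ((r - ε / K) ^ n * K) := by
          gcongr
          exact h2.trans (by gcongr)
        _ = _ := by ring
    have := csInf_le hSbb hmem
    linarith
  -- Hahn-Banach
  set P : Set C(X, ℝ) := {g | ∀ x, 0 < g x} with hP
  have hPo : IsOpen P := by
    have := ContinuousMap.isOpen_setOfPred_mapsTo (X := X) (Y := ℝ) isCompact_univ (isOpen_Ioi (a := (0:ℝ)))
    convert this using 1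
    ext g; simp [hP, MapsTo]
  have hPc : Convex ℝ P := by
    intro g hg k hk a b ha hb hab x
    have h1 := hg x
    have h2 := hk x
    change 0 < a * g x + b * k x
    rcases ha.eq_or_lt with rfl | ha
    · have : b = 1 := by linarith
      subst this; linarith
    · have := mul_pos ha h1
      have := mul_nonneg hb h2.le
      linarith
  set W : Submodule ℝ C(X, ℝ) := LinearMap.range (r • LinearMap.id - L) with hW
  have hdisj : Disjoint P (W : Set C(X, ℝ)) := by
    rw [Set.disjoint_left]
    rintro g hg ⟨k, rfl⟩
    exact hno k (fun x => by simpa using hg x)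
  obtain ⟨ℓ, u, h1, h2⟩ := geometric_hahn_banach_open hPc hPo W.convex hdisj
  have hu : u ≤ 0 := by simpa using h2 0 W.zero_mem
  have hW0 : ∀ w ∈ W, ℓ w = 0 := by
    intro w hw
    by_contra hne
    have := h2 (((u - 1) / ℓ w) • w) (W.smul_mem _ hw)
    rw [map_smul, smul_eq_mul, div_mul_cancel₀ _ hne] at this
    linarith
  have hone : ℓ 1 < 0 := (h1 1 (by intro x; simp)).trans_le hu
  have hge : ∀ g : C(X, ℝ), (∀ x, 0 ≤ g x) → ℓ g ≤ 0 := by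
    intro g hg
    apply le_of_forall_pos_le_add
    intro ε hε
    have := (h1 (g + (ε / (-ℓ 1)) • 1) (by
      intro x
      have h3 := hg x
      have : 0 < ε / (-ℓ 1) := div_pos hε (by linarith)
      change 0 < g x + ε / (-ℓ 1) * 1
      linarith)).trans_le hu
    rw [map_add, map_smul, smul_eq_mul] at this
    have e : ε / (-ℓ 1) * ℓ 1 = -ε := by
      have hne : ℓ 1 ≠ 0 := hone.ne
      rw [div_neg, neg_mul, div_mul_cancel₀ _ hne]
    linarith
  refine ⟨r, (ℓ 1)⁻¹ • (ℓ : C(X, ℝ) →ₗ[ℝ] ℝ), hrpos, ?_, ?_, ?_⟩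
  · intro g hg
    have := hge g hg
    change 0 ≤ (ℓ 1)⁻¹ * ℓ g
    exact mul_nonneg_of_nonpos_of_nonpos (inv_nonpos.2 hone.le) this
  · change (ℓ 1)⁻¹ * ℓ 1 = 1
    exact inv_mul_cancel₀ hone.ne
  · intro g
    change (ℓ 1)⁻¹ * ℓ (L g) = r * ((ℓ 1)⁻¹ * ℓ g)
    have := hW0 _ (LinearMap.mem_range_self (r • LinearMap.id - L) g)
    have h3 : ℓ (r • g - L g) = 0 := this
    rw [map_sub, map_smul, smul_eq_mul] at h3
    have : ℓ (L g) = r * ℓ g := by linarith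
    rw [this]; ring


theorem aux_partition {X : Type*} [MetricSpace X] [CompactSpace X] [Nonempty X]
    [MeasurableSpace X] [BorelSpace X] (f : X → X) (hexp : DistanceExpanding f) :
    ∃ A : ℕ → Set X, (∀ n, MeasurableSet (A n)) ∧ Pairwise (Function.onFun Disjoint A) ∧
      (⋃ n, A n) = univ ∧ ∀ n, InjOn f (A n) := by
  obtain ⟨lam, hl, η, hη, h⟩ := hexp
  set B : ℕ → Set X := fun n => ball (TopologicalSpace.denseSeq X n) (η/2) with hB
  refine ⟨disjointed B, fun n => MeasurableSet.disjointed (fun n => measurableSet_ball) n,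
    disjoint_disjointed B, ?_, fun n => InjOn.mono (disjointed_subset B n) ?_⟩
  · rw [iUnion_disjointed, eq_univ_iff_forall]
    intro x
    obtain ⟨_, hn2, ⟨n, rfl⟩⟩ := Metric.dense_iff.1 (TopologicalSpace.denseRange_denseSeq X) x (η/2) (by positivity) 
    refine mem_iUnion.2 ⟨n, ?_⟩
    simpa [hB, dist_comm] using hn2
  · intro x hx y hy hxy
    simp only [hB, mem_ball] at hx hy
    have h1 := dist_triangle_right x y (TopologicalSpace.denseSeq X n)
    have := h x y (by linarith)
    rw [hxy, dist_self] at this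
    have h3 : dist x y ≤ 0 := by
      by_contra hh
      push Not at hh
      nlinarith
    exact dist_le_zero.1 h3

noncomputable def fibM {X : Type*} [MeasurableSpace X] (F : X → Finset X) (x : X) : Measure X :=
  ∑ u ∈ F x, Measure.dirac u

section
variable {X : Type*} [MetricSpace X] [CompactSpace X] [Nonempty X]
    [MeasurableSpace X] [BorelSpace X]

theorem fibM_apply (f : X → X) (F : X → Finset X) (hF : ∀ x u, u ∈ F x ↔ f u = x)
    (x : X) (Y : Set X) (hY : MeasurableSet Y) (hi : InjOn f Y) :
    fibM F x Y = (f '' Y).indicator 1 x := by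
  classical
  rw [fibM, Measure.finsetSum_apply]
  simp only [Measure.dirac_apply' _ hY]
  by_cases hx : x ∈ f '' Y
  · obtain ⟨u, hu, rfl⟩ := hx
    rw [Finset.sum_eq_single u]
    · simp [hu, mem_image_of_mem f hu]
    · intro v hv hne
      rw [indicator_of_notMem]
      intro hvY
      exact hne (hi hvY hu ((hF _ _).1 hv))
    · intro hh; exact absurd ((hF _ _).2 rfl) hh
  · rw [indicator_of_notMem hx]
    apply Finset.sum_eq_zero
    intro u hu
    rw [indicator_of_notMem]
    intro huY
    exact hx ⟨u, huY, (hF _ _).1 hu⟩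

theorem measure_split (A : ℕ → Set X) (hA : ∀ n, MeasurableSet (A n))
    (hd : Pairwise (Function.onFun Disjoint A)) (hU : (⋃ n, A n) = univ) (μ : Measure X)
    (Y : Set X) (hY : MeasurableSet Y) : μ Y = ∑' n, μ (Y ∩ A n) := by
  rw [← measure_iUnion, ← inter_iUnion, hU, inter_univ]
  · intro i j hij
    exact (hd hij).mono inter_subset_right inter_subset_right
  · exact fun n => hY.inter (hA n)

theorem fibM_measurable (f : X → X) (hf : Continuous f) (F : X → Finset X)
    (hF : ∀ x u, u ∈ F x ↔ f u = x) (hexp : DistanceExpanding f) : Measurable (fibM F) := by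
  obtain ⟨A, hA, hd, hU, hi⟩ := aux_partition f hexp
  apply Measure.measurable_of_measurable_coe
  intro Y hY
  have : (fun x => fibM F x Y) = fun x => ∑' n, (f '' (Y ∩ A n)).indicator 1 x := by
    ext x
    rw [measure_split A hA hd hU _ Y hY]
    congr 1
    ext n
    exact fibM_apply f F hF x _ (hY.inter (hA n)) ((hi n).mono inter_subset_right)
  rw [this]
  apply Measurable.ennreal_tsum
  intro n
  apply measurable_one.indicator
  exact (hY.inter (hA n)).image_of_continuousOn_injOn hf.continuousOn ((hi n).mono inter_subset_right)

theorem bind_fibM (f : X → X) (hf : Continuous f) (F : X → Finset X)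
    (hF : ∀ x u, u ∈ F x ↔ f u = x) (hexp : DistanceExpanding f) (m : Measure X) (Y : Set X) (hY : MeasurableSet Y)
    (hi : InjOn f Y) : m.bind (fibM F) Y = m (f '' Y) := by
  rw [Measure.bind_apply hY (fibM_measurable f hf F hF hexp).aemeasurable]
  simp only [fibM_apply f F hF _ Y hY hi]
  rw [lintegral_indicator_one]
  exact hY.image_of_continuousOn_injOn hf.continuousOn hi

theorem conformal_iff (f : X → X) (hf : Continuous f) (F : X → Finset X)
    (hF : ∀ x u, u ∈ F x ↔ f u = x) (hexp : DistanceExpanding f) (φ : X → ℝ) (hφ : Continuous φ)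
    (m : Measure X) [IsProbabilityMeasure m] (lam : ℝ) (hl : 0 < lam) :
    (∀ Y : Set X, MeasurableSet Y → Set.InjOn f Y →
        (m (f '' Y)).toReal = lam * ∫ y in Y, Real.exp (-(φ y)) ∂m) ↔
    m.bind (fibM F) = m.withDensity (fun x => ENNReal.ofReal (lam * Real.exp (-(φ x)))) := by
  have hIntegr : Integrable (fun x => lam * Real.exp (-(φ x))) m := by
    have hc : Continuous (fun x => lam * Real.exp (-(φ x))) := by fun_prop
    exact hc.integrable_of_hasCompactSupport (HasCompactSupport.of_compactSpace _)
  have key : ∀ Y : Set X, MeasurableSet Y →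
      m.withDensity (fun x => ENNReal.ofReal (lam * Real.exp (-(φ x)))) Y
        = ENNReal.ofReal (lam * ∫ y in Y, Real.exp (-(φ y)) ∂m) := by
    intro Y hY
    rw [withDensity_apply _ hY, ← integral_const_mul, ofReal_integral_eq_lintegral_ofReal]
    · exact hIntegr.integrableOn
    · exact Eventually.of_forall fun x => by positivity
  constructor
  · intro h
    obtain ⟨A, hA, hd, hU, hi⟩ := aux_partition f hexp
    ext Y hY
    rw [measure_split A hA hd hU _ Y hY, measure_split A hA hd hU (m.withDensity _) Y hY]
    congr 1
    ext n
    have hYn := hY.inter (hA n)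
    have hin := (hi n).mono (inter_subset_right (s := Y))
    rw [bind_fibM f hf F hF hexp m _ hYn hin, key _ hYn, ← h _ hYn hin,
      ENNReal.ofReal_toReal (measure_ne_top _ _)]
  · intro h Y hY hi
    rw [← bind_fibM f hf F hF hexp m _ hY hi, h, key _ hY, ENNReal.toReal_ofReal]
    apply mul_nonneg hl.le
    exact integral_nonneg fun x => (Real.exp_pos _).le

theorem lintegral_bind_fibM (f : X → X) (hf : Continuous f) (F : X → Finset X)
    (hF : ∀ x u, u ∈ F x ↔ f u = x) (hexp : DistanceExpanding f) (φ : X → ℝ) (hφ : Continuous φ)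
    (L : C(X, ℝ) →ₗ[ℝ] C(X, ℝ)) (hL : ∀ g x, L g x = ∑ u ∈ F x, Real.exp (φ u) * g u)
    (m : Measure X) [IsProbabilityMeasure m] (g : C(X, ℝ)) (hg : ∀ x, 0 ≤ g x) :
    ∫⁻ x, ENNReal.ofReal (Real.exp (φ x) * g x) ∂(m.bind (fibM F)) = ENNReal.ofReal (∫ x, L g x ∂m) := by
  have hm : Measurable (fun x => ENNReal.ofReal (Real.exp (φ x) * g x)) := by
    have : Continuous (fun x => Real.exp (φ x) * g x) := by fun_prop
    exact this.measurable.ennreal_ofReal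
  rw [Measure.lintegral_bind (fibM_measurable f hf F hF hexp).aemeasurable hm.aemeasurable,
    ofReal_integral_eq_lintegral_ofReal]
  · congr 1
    ext x
    rw [fibM, lintegral_finsetSum_measure, hL, ENNReal.ofReal_sum_of_nonneg]
    · apply Finset.sum_congr rfl
      intro u _
      rw [lintegral_dirac' _ hm]
    · intro u _
      exact mul_nonneg (Real.exp_pos _).le (hg u)
  · exact (L g).continuous.integrable_of_hasCompactSupport (HasCompactSupport.of_compactSpace _)
  · exact Eventually.of_forall fun x => by
      rw [hL]
      exact Finset.sum_nonneg fun u _ => mul_nonneg (Real.exp_pos _).le (hg u)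

theorem lintegral_wd (φ : X → ℝ) (hφ : Continuous φ)
    (m : Measure X) [IsProbabilityMeasure m] (lam : ℝ) (hl : 0 < lam) (g : C(X, ℝ)) (hg : ∀ x, 0 ≤ g x) :
    ∫⁻ x, ENNReal.ofReal (Real.exp (φ x) * g x)
      ∂(m.withDensity (fun x => ENNReal.ofReal (lam * Real.exp (-(φ x))))) =
      ENNReal.ofReal (lam * ∫ x, g x ∂m) := by
  have hm : Measurable (fun x => ENNReal.ofReal (Real.exp (φ x) * g x)) := by
    have : Continuous (fun x => Real.exp (φ x) * g x) := by fun_prop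
    exact this.measurable.ennreal_ofReal
  have hm2 : Measurable (fun x => ENNReal.ofReal (lam * Real.exp (-(φ x)))) := by
    have : Continuous (fun x => lam * Real.exp (-(φ x))) := by fun_prop
    exact this.measurable.ennreal_ofReal
  rw [lintegral_withDensity_eq_lintegral_mul _ hm2 hm, ← integral_const_mul,
    ofReal_integral_eq_lintegral_ofReal]
  · congr 1
    ext x
    rw [Pi.mul_apply, ← ENNReal.ofReal_mul (by positivity)]
    congr 1
    rw [Real.exp_neg]
    field_simp
  · exact (g.continuous.integrable_of_hasCompactSupport (HasCompactSupport.of_compactSpace _)).const_mul _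
  · exact Eventually.of_forall fun x => mul_nonneg hl.le (hg x)

theorem cm_integrable (m : Measure X) [IsProbabilityMeasure m] (g : C(X, ℝ)) :
    Integrable (fun x => g x) m :=
  g.continuous.integrable_of_hasCompactSupport (HasCompactSupport.of_compactSpace _)

noncomputable def intF (m : Measure X) [IsProbabilityMeasure m] : C(X, ℝ) →ₗ[ℝ] ℝ where
  toFun g := ∫ x, g x ∂m
  map_add' g h := integral_add (cm_integrable m g) (cm_integrable m h)
  map_smul' c g := integral_const_mul c _

theorem conformal_eig (f : X → X) (hf : Continuous f) (F : X → Finset X)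
    (hF : ∀ x u, u ∈ F x ↔ f u = x) (hexp : DistanceExpanding f) (φ : X → ℝ) (hφ : Continuous φ)
    (L : C(X, ℝ) →ₗ[ℝ] C(X, ℝ)) (hL : ∀ g x, L g x = ∑ u ∈ F x, Real.exp (φ u) * g u)
    (m : Measure X) [IsProbabilityMeasure m] (lam : ℝ) (hl : 0 < lam)
    (h : ∀ Y : Set X, MeasurableSet Y → Set.InjOn f Y →
        (m (f '' Y)).toReal = lam * ∫ y in Y, Real.exp (-(φ y)) ∂m) :
    EigF L lam (intF m) := by
  rw [conformal_iff f hf F hF hexp φ hφ m lam hl] at h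
  have hpos : ∀ g : C(X, ℝ), (∀ x, 0 ≤ g x) → intF m (L g) = lam * intF m g := by
    intro g hg
    have h1 := lintegral_bind_fibM f hf F hF hexp φ hφ L hL m g hg
    rw [h, lintegral_wd φ hφ m lam hl g hg] at h1
    refine ((ENNReal.ofReal_eq_ofReal_iff ?_ ?_).1 h1).symm
    · exact mul_nonneg hl.le (integral_nonneg hg)
    · exact integral_nonneg fun x => by
        rw [hL]
        exact Finset.sum_nonneg fun u _ => mul_nonneg (Real.exp_pos _).le (hg u)
  refine ⟨hl, fun g hg => integral_nonneg hg, by simp [intF], fun g => ?_⟩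
  have h1 := hpos (g + ‖g‖ • 1) (fun x => by
    have := (abs_le.1 (g.norm_coe_le_norm x)).1
    change 0 ≤ g x + ‖g‖ * 1
    linarith)
  have h2 := hpos (‖g‖ • 1) (fun x => by
    change 0 ≤ ‖g‖ * 1
    positivity)
  rw [map_add, map_add, map_add, h2] at h1
  linarith

theorem eig_conformal (f : X → X) (hf : Continuous f) (F : X → Finset X)
    (hF : ∀ x u, u ∈ F x ↔ f u = x) (hexp : DistanceExpanding f) (φ : X → ℝ) (hφ : Continuous φ)
    (L : C(X, ℝ) →ₗ[ℝ] C(X, ℝ)) (hL : ∀ g x, L g x = ∑ u ∈ F x, Real.exp (φ u) * g u)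
    (m : Measure X) [IsProbabilityMeasure m] (lam : ℝ) 
    (h : EigF L lam (intF m)) :
    ∀ Y : Set X, MeasurableSet Y → Set.InjOn f Y →
        (m (f '' Y)).toReal = lam * ∫ y in Y, Real.exp (-(φ y)) ∂m := by
  have hl := h.lpos
  rw [conformal_iff f hf F hF hexp φ hφ m lam hl]
  symm
  have hIntegr : Integrable (fun x => lam * Real.exp (-(φ x))) m := by
    have hc : Continuous (fun x => lam * Real.exp (-(φ x))) := by fun_prop
    exact hc.integrable_of_hasCompactSupport (HasCompactSupport.of_compactSpace _)
  have : IsFiniteMeasure (m.withDensity (fun x => ENNReal.ofReal (lam * Real.exp (-(φ x))))) :=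
    isFiniteMeasure_withDensity_ofReal hIntegr.2
  apply ext_of_forall_lintegral_eq_of_IsFiniteMeasure
  intro w
  let g : C(X, ℝ) := ⟨fun x => Real.exp (-(φ x)) * w x, by fun_prop⟩
  have hg : ∀ x, 0 ≤ g x := fun x => mul_nonneg (Real.exp_pos _).le (w x).2
  have hw : (fun x => ((w x : NNReal) : ENNReal)) = fun x => ENNReal.ofReal (Real.exp (φ x) * g x) := by
    ext x
    have : Real.exp (φ x) * g x = w x := by
      change Real.exp (φ x) * (Real.exp (-(φ x)) * w x) = w x
      rw [Real.exp_neg]; field_simp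
    rw [this, ENNReal.ofReal_coe_nnreal]
  rw [hw, lintegral_wd φ hφ m lam hl g hg, lintegral_bind_fibM f hf F hF hexp φ hφ L hL m g hg]
  congr 1
  exact (h.eig g).symm

theorem intF_inj (m₁ m₂ : Measure X) [IsProbabilityMeasure m₁] [IsProbabilityMeasure m₂]
    (h : intF m₁ = intF m₂) : m₁ = m₂ := by
  apply ext_of_forall_integral_eq_of_IsFiniteMeasure
  intro g
  exact LinearMap.congr_fun h g.toContinuousMap

theorem exists_intF (L : C(X, ℝ) →ₗ[ℝ] C(X, ℝ)) (lam : ℝ) (ν : C(X, ℝ) →ₗ[ℝ] ℝ) (h : EigF L lam ν) :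
    ∃ (m : Measure X) (_ : IsProbabilityMeasure m), intF m = ν := by
  let Λ : CompactlySupportedContinuousMap X ℝ →ₚ[ℝ] ℝ :=
    { toFun := fun g => ν g.toContinuousMap
      map_add' := fun g k => ν.map_add g.toContinuousMap k.toContinuousMap
      map_smul' := fun c g => ν.map_smul c g.toContinuousMap
      monotone' := fun g k hgk => h.mono hgk }
  have key : ∀ g : C(X, ℝ), ∫ x, g x ∂(RealRMK.rieszMeasure Λ) = ν g := fun g =>
    RealRMK.integral_rieszMeasure Λ ⟨g, HasCompactSupport.of_compactSpace _⟩
  have h1 := key 1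
  rw [h.one] at h1
  have hp : IsProbabilityMeasure (RealRMK.rieszMeasure Λ) := by
    constructor
    have h2 : (RealRMK.rieszMeasure Λ).real univ = 1 := by simpa using h1
    rw [measureReal_def] at h2
    exact (ENNReal.toReal_eq_one_iff _).1 h2
  exact ⟨_, hp, LinearMap.ext key⟩
end

/-- **Existence and uniqueness of the conformal measure.** There is exactly one pair
`(lam, m)` with `lam > 0` and `m` a Borel probability measure such that
`m (f '' Y) = lam * ∫_Y e^{-φ} dm` for every Borel set `Y` on which `f` is injective. -/
theorem conformal_measure_unique {X : Type*} [MetricSpace X] [CompactSpace X]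
    [Nonempty X] [MeasurableSpace X] [BorelSpace X]
    (f : X → X) (φ : X → ℝ) (hf : Continuous f) (hopen : IsOpenMap f)
    (hexp : DistanceExpanding f) (htrans : TopologicallyTransitive f)
    (hφ : HolderPotential φ) :
    ∃! p : ℝ × Measure X, 0 < p.1 ∧ IsProbabilityMeasure p.2 ∧
      ∀ Y : Set X, MeasurableSet Y → Set.InjOn f Y →
        (p.2 (f '' Y)).toReal = p.1 * ∫ y in Y, Real.exp (-(φ y)) ∂p.2 := by
  obtain ⟨C, hC, b, ⟨hb, -⟩, hH⟩ := hφ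
  have hφc : Continuous φ := aux_cont φ C b hb hH
  obtain ⟨F, hF, κ, hκ, hκ1, δ, hδ, hp⟩ := aux_pair f hf hopen hexp
  obtain ⟨L, hL⟩ := aux_op φ hφc F κ hκ hκ1 δ hδ hp
  obtain ⟨K, hK, hd⟩ := aux_dist φ F κ hκ hκ1 δ hδ hp C b hC hb hH L hL
  obtain ⟨D, hD, N, hcmp⟩ := aux_comp f φ hφc htrans F hF δ hδ L hL K hK hd
  have hsurj := aux_surj f hf hopen htrans
  obtain ⟨B, hB⟩ := isCompact_univ.exists_bound_of_continuousOn hφc.continuousOn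
  have hlow : ∀ x, Real.exp (-B) ≤ L 1 x := by
    intro x
    obtain ⟨u, hu⟩ := hsurj x
    rw [hL]
    have h1 : Real.exp (φ u) * (1 : C(X, ℝ)) u ≤ ∑ v ∈ F x, Real.exp (φ v) * (1 : C(X, ℝ)) v :=
      Finset.single_le_sum (f := fun v => Real.exp (φ v) * (1 : C(X, ℝ)) v)
        (fun v _ => by simpa using (Real.exp_pos _).le) ((hF _ _).2 hu)
    refine le_trans ?_ h1
    have := (abs_le.1 (hB u (mem_univ u))).1
    simpa using this
  obtain ⟨lam, ν, hν⟩ := aux_exists L (aux_pos φ F L hL) (Real.exp (-B)) (Real.exp_pos _) hlow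
  obtain ⟨m, hm, hmν⟩ := exists_intF L lam ν hν
  subst hmν
  refine ⟨(lam, m), ⟨hν.lpos, hm, eig_conformal f hf F hF hexp φ hφc L hL m lam hν⟩, ?_⟩
  rintro ⟨lam', m'⟩ ⟨hl', hm', hc'⟩
  have h' := conformal_eig f hf F hF hexp φ hφc L hL m' lam' hl' hc'
  have hle : lam' = lam := le_antisymm (EigF.lam_le D hD N hcmp h' hν) (EigF.lam_le D hD N hcmp hν h')
  dsimp only at *
  subst hle
  have := intF_inj m' m (EigF.unique D hD N hcmp h' hν)
  rw [this]
end

section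
/- Let (X,d) be a nonempty compact metric space, f : X → X a continuous, open, distance expanding, topologically transitive map, and φ : X → ℝ Hölder continuous. Let μ be an f-invariant Borel probability measure satisfying the Gibbs property for φ (with some constants C ∈ (0,1], P ∈ ℝ, r₀ > 0), and let m be a Borel probability measure that is φ-conformal with parameter λ = e^P. Then μ and m are equivalent, i.e. μ ≪ m and m ≪ μ. -/
open MeasureTheory Filter Metric Set

/-- local expansion and local surjectivity at scale `r`. -/
structure LocExp {X : Type*} [MetricSpace X] (f : X → X) (r lam : ℝ) : Prop where
  rpos : 0 < r
  lam_gt : 1 < lam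
  expand : ∀ x y : X, dist x y ≤ 2 * r → lam * dist x y ≤ dist (f x) (f y)
  lift : ∀ x w : X, dist (f x) w < r → ∃ y, dist x y < r ∧ f y = w

lemma exists_locExp {X : Type*} [MetricSpace X] [CompactSpace X] (f : X → X)
    (hf : Continuous f) (hopen : IsOpenMap f) (hexp : DistanceExpanding f)
    (r₀ : ℝ) (hr₀ : 0 < r₀) : ∃ r lam, LocExp f r lam ∧ r ≤ r₀ := by
  obtain ⟨lam, hlam, η, hη, h⟩ := hexp
  have hG : IsOpen ((Prod.map id f) '' {p : X × X | dist p.1 p.2 < η}) :=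
    (IsOpenMap.id.prodMap hopen) _ (isOpen_lt (by fun_prop) (by fun_prop))
  have hK : IsCompact (Set.range fun x : X => (x, f x)) :=
    isCompact_range (by fun_prop)
  obtain ⟨δ, hδ, hsub⟩ := hK.exists_thickening_subset_open hG (by
    rintro _ ⟨x, rfl⟩
    exact ⟨(x, x), by simpa using hη, rfl⟩)
  refine ⟨min (min δ (η / 2)) r₀, lam, ⟨by positivity, hlam, ?_, ?_⟩, min_le_right _ _⟩
  · intro x y hxy
    apply h
    have : min (min δ (η / 2)) r₀ ≤ η / 2 := (min_le_left _ _).trans (min_le_right _ _)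
    linarith
  · intro x w hw
    have h1 : dist (f x) w < δ := lt_of_lt_of_le hw ((min_le_left _ _).trans (min_le_left _ _))
    have h2 : (x, w) ∈ Metric.thickening δ (Set.range fun x : X => (x, f x)) := by
      rw [Metric.mem_thickening_iff]
      refine ⟨(x, f x), ⟨x, rfl⟩, ?_⟩
      rw [Prod.dist_eq]
      simp only [dist_self]
      rw [dist_comm]
      exact max_lt hδ h1
    obtain ⟨⟨a, y⟩, hay, he⟩ := hsub h2
    simp only [Prod.map, id, Prod.mk.injEq] at he
    obtain ⟨rfl, rfl⟩ := he
    have hay' : dist a y < η := hay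
    refine ⟨y, ?_, rfl⟩
    have h3 := h a y hay'.le
    nlinarith [dist_nonneg (x := a) (y := y)]

lemma LocExp.lift' {X : Type*} [MetricSpace X] {f : X → X} {r lam : ℝ} (h : LocExp f r lam)
    {s : ℝ} (hs : s ≤ r) (x w : X) (hw : dist (f x) w < s) : ∃ y, dist x y < s ∧ f y = w := by
  obtain ⟨y, hy, rfl⟩ := h.lift x w (hw.trans_le hs)
  refine ⟨y, ?_, rfl⟩
  have h3 := h.expand x y (by linarith [h.rpos])
  nlinarith [dist_nonneg (x := x) (y := y), h.lam_gt]

lemma mem_bowenBall_succ {X : Type*} [MetricSpace X] {f : X → X} {n : ℕ} {x y : X} {s : ℝ} :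
    y ∈ bowenBall f (n + 1) x s ↔ dist x y < s ∧ f y ∈ bowenBall f n (f x) s := by
  constructor
  · intro h
    exact ⟨h 0 (by omega), fun j hj => h (j + 1) (by omega)⟩
  · rintro ⟨h0, h1⟩ j hj
    rcases j with _ | j
    · exact h0
    · exact h1 j (by omega)

lemma isOpen_bowenBall {X : Type*} [MetricSpace X] {f : X → X} (hf : Continuous f) (n : ℕ)
    (x : X) (s : ℝ) : IsOpen (bowenBall f n x s) := by
  induction n generalizing x with
  | zero =>
    have : bowenBall f 0 x s = {y | dist x y < s} := by
      ext y; simp [bowenBall]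
    rw [this]
    exact isOpen_lt (by fun_prop) (by fun_prop)
  | succ n ih =>
    have : bowenBall f (n + 1) x s = {y | dist x y < s} ∩ f ⁻¹' bowenBall f n (f x) s := by
      ext y; exact mem_bowenBall_succ
    rw [this]
    exact (isOpen_lt (by fun_prop) (by fun_prop)).inter ((ih _).preimage hf)

lemma bowenBall_mono {X : Type*} [MetricSpace X] (f : X → X) (n : ℕ) (x : X) {s t : ℝ}
    (h : s ≤ t) : bowenBall f n x s ⊆ bowenBall f n x t :=
  fun _ hy j hj => (hy j hj).trans_le h

lemma LocExp.contr {X : Type*} [MetricSpace X] {f : X → X} {r lam : ℝ} (h : LocExp f r lam)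
    (n : ℕ) (x y : X) (hy : y ∈ bowenBall f n x r) : lam ^ n * dist x y < r := by
  induction n generalizing x y with
  | zero => simpa using hy 0 le_rfl
  | succ n ih =>
    rw [mem_bowenBall_succ] at hy
    have h1 := ih _ _ hy.2
    have h2 := h.expand x y (by linarith [h.rpos, hy.1])
    have h3 : 0 < lam ^ n := pow_pos (by linarith [h.lam_gt]) n
    calc lam ^ (n + 1) * dist x y = lam ^ n * (lam * dist x y) := by ring
      _ ≤ lam ^ n * dist (f x) (f y) := by gcongr
      _ < r := h1

lemma LocExp.image {X : Type*} [MetricSpace X] {f : X → X} {r lam : ℝ} (h : LocExp f r lam)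
    {s : ℝ} (hs : s ≤ r) (n : ℕ) (x : X) :
    ball (f^[n] x) s ⊆ f^[n] '' bowenBall f n x s := by
  induction n generalizing x with
  | zero =>
    intro y hy
    refine ⟨y, ?_, rfl⟩
    intro j hj
    obtain rfl : j = 0 := by omega
    rw [dist_comm]
    exact hy
  | succ n ih =>
    intro w hw
    obtain ⟨v, hv, rfl⟩ := ih (f x) hw
    obtain ⟨y, hy, rfl⟩ := h.lift' hs x v (hv 0 (by omega))
    exact ⟨y, mem_bowenBall_succ.2 ⟨hy, hv⟩, rfl⟩

lemma LocExp.injOn {X : Type*} [MetricSpace X] {f : X → X} {r lam : ℝ} (h : LocExp f r lam)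
    {Y : Set X} {x : X} (hY : ∀ y ∈ Y, dist x y < r) : InjOn f Y := by
  intro a ha b hb hab
  have h1 : dist a b ≤ 2 * r := by
    have := dist_triangle_left a b x
    linarith [hY a ha, hY b hb]
  have h2 := h.expand a b h1
  rw [hab, dist_self] at h2
  have : dist a b ≤ 0 := by
    nlinarith [dist_nonneg (x := a) (y := b), h.lam_gt]
  exact dist_le_zero.1 this

/-- Covering by transitivity. -/
lemma LocExp.cover {X : Type*} [MetricSpace X] {f : X → X} {r lam : ℝ} (h : LocExp f r lam)
    (htrans : TopologicallyTransitive f) (U : Set X) (hU : IsOpen U) (hne : U.Nonempty) (x : X) :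
    ∃ n, ∃ y ∈ U, f^[n] y = x := by
  obtain ⟨z, hz⟩ := hne
  obtain ⟨ε, hε, hsub⟩ := Metric.isOpen_iff.1 hU z hz
  have hr := h.rpos
  set s := min r (ε / 2)
  have hs : 0 < s := by positivity
  obtain ⟨n, w, ⟨y, hy, rfl⟩, hw⟩ := htrans (ball z s) (ball x s) isOpen_ball isOpen_ball
    ⟨z, mem_ball_self hs⟩ ⟨x, mem_ball_self hs⟩
  have : x ∈ ball (f^[n] y) s := by rwa [mem_ball_comm]
  obtain ⟨v, hv, rfl⟩ := h.image (min_le_left _ _) n y this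
  refine ⟨n, v, hsub ?_, rfl⟩
  have h0 : dist y v < s := hv 0 (by omega)
  have hsε : s ≤ ε / 2 := min_le_right _ _
  rw [mem_ball] at hy ⊢
  have := dist_triangle_left v z y
  have h4 : dist y z < s := hy
  linarith

/-- Covering lemma. -/
lemma LocExp.absCont {X : Type*} [MetricSpace X] [CompactSpace X] [MeasurableSpace X]
    [BorelSpace X] {f : X → X} {r lam : ℝ} (h : LocExp f r lam) (hf : Continuous f)
    (ν m : Measure X) [IsFiniteMeasure ν] [IsFiniteMeasure m] (c : ENNReal) (hc : c ≠ ⊤)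
    (hb : ∀ n x, ν (bowenBall f n x r) ≤ c * m (bowenBall f n x (r / 2))) : ν ≪ m := by
  have hr := h.rpos
  have key : ∀ K U : Set X, IsCompact K → IsOpen U → K ⊆ U → ν K ≤ c * m U := by
    intro K U hK hU hKU
    obtain ⟨δ, hδ, hsub⟩ := hK.exists_thickening_subset_open hU hKU
    obtain ⟨n, hn⟩ := pow_unbounded_of_one_lt (r / δ) h.lam_gt
    have hin : ∀ x ∈ K, bowenBall f n x (r / 2) ⊆ U := by
      intro x hx y hy
      apply hsub
      rw [Metric.mem_thickening_iff]
      refine ⟨x, hx, ?_⟩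
      have h1 := h.contr n x y (bowenBall_mono f n x (by linarith) hy)
      rw [div_lt_iff₀ hδ] at hn
      rw [dist_comm]
      have h3 : 0 < lam ^ n := pow_pos (by linarith [h.lam_gt]) n
      exact lt_of_mul_lt_mul_left (h1.trans hn) h3.le
    have hself : ∀ x, x ∈ bowenBall f n x (r / 2) := fun x j _ => by simpa using hr
    obtain ⟨u, huK, hdisj, hcov⟩ := Vitali.exists_disjoint_subfamily_covering_enlargement
      (fun x => bowenBall f n x (r / 2)) K (fun _ => 1) 2 (by norm_num) (by simp) 1 (by simp)
      (fun x _ => ⟨x, hself x⟩)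
    have hcount : u.Countable := hdisj.countable_of_isOpen
      (fun i _ => isOpen_bowenBall hf n i _) (fun i _ => ⟨i, hself i⟩)
    have hKc : K ⊆ ⋃ b ∈ u, bowenBall f n b r := by
      intro a ha
      obtain ⟨b, hb, ⟨w, hwa, hwb⟩, -⟩ := hcov a ha
      refine mem_iUnion₂.2 ⟨b, hb, fun j hj => ?_⟩
      have h1 := hwa j hj
      have h2 := hwb j hj
      have := dist_triangle_right (f^[j] b) (f^[j] a) (f^[j] w)
      linarith
    calc ν K ≤ ν (⋃ b ∈ u, bowenBall f n b r) := measure_mono hKc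
      _ ≤ ∑' b : u, ν (bowenBall f n b r) := measure_biUnion_le _ hcount _
      _ ≤ ∑' b : u, c * m (bowenBall f n b (r / 2)) := ENNReal.tsum_le_tsum fun b => hb n b
      _ = c * ∑' b : u, m (bowenBall f n b (r / 2)) := ENNReal.tsum_mul_left
      _ = c * m (⋃ b ∈ u, bowenBall f n b (r / 2)) := by
        rw [measure_biUnion hcount hdisj fun i _ => (isOpen_bowenBall hf n i _).measurableSet]
      _ ≤ c * m U := by
        gcongr
        exact iUnion₂_subset fun b hb => hin b (huK hb)
  refine Measure.AbsolutelyContinuous.mk fun E hE hmE => ?_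
  by_contra hne
  obtain ⟨K, hKE, hK, hpos⟩ := hE.exists_lt_isCompact_of_ne_top (measure_ne_top ν E)
    (pos_iff_ne_zero.2 hne)
  have hmK : m K = 0 := measure_mono_null hKE hmE
  have hcpos : ν K / (c + 1) ≠ 0 := by
    refine (ENNReal.div_pos hpos.ne' ?_).ne'
    exact ENNReal.add_ne_top.2 ⟨hc, ENNReal.one_ne_top⟩
  obtain ⟨U, hKU, hU, hlt⟩ := K.exists_isOpen_lt_of_lt (μ := m) (ν K / (c + 1)) (by
    rw [hmK]; exact pos_iff_ne_zero.2 hcpos)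
  have h1 := key K U hK hU hKU
  have h2 : (c + 1) * m U < ν K := by
    have := (ENNReal.lt_div_iff_mul_lt (by simp) (by simp [hc])).1 hlt
    rwa [mul_comm]
  have : c * m U ≤ (c + 1) * m U := by gcongr; exact le_self_add
  exact absurd (h1.trans this) (not_le.2 h2)

lemma HolderPotential.cont {X : Type*} [MetricSpace X] {φ : X → ℝ} (h : HolderPotential φ) :
    Continuous φ := by
  obtain ⟨C, hC, b, hb, h⟩ := h
  rw [continuous_iff_continuousAt]
  intro x
  rw [ContinuousAt, tendsto_iff_dist_tendsto_zero]
  have h0 : Tendsto (fun y => C * dist y x ^ b) (nhds x) (nhds 0) := by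
    have : ContinuousAt (fun y => C * dist y x ^ b) x := by
      refine ContinuousAt.mul continuousAt_const (ContinuousAt.rpow_const (by fun_prop) ?_)
      exact Or.inr hb.1.le
    have h1 := this.tendsto
    simpa [Real.zero_rpow hb.1.ne'] using h1
  exact squeeze_zero (fun _ => dist_nonneg) (fun y => by rw [Real.dist_eq]; exact h y x) h0

lemma LocExp.holder {X : Type*} [MetricSpace X] {f : X → X} {r lam : ℝ} (h : LocExp f r lam)
    {φ : X → ℝ} (hφ : HolderPotential φ) :
    ∃ D ≥ (0 : ℝ), ∃ q ∈ Set.Ioo (0 : ℝ) 1, ∀ n x y, y ∈ bowenBall f n x r →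
      |φ y - φ x| ≤ D * (q ^ n - q ^ (n + 1)) := by
  obtain ⟨c, hc, b, hb, hφ⟩ := hφ
  have hr := h.rpos
  have hlam := h.lam_gt
  have hl0 : 0 < lam := by linarith
  have hlb : 1 < lam ^ b := Real.one_lt_rpow hlam hb.1
  have hq : (lam ^ b)⁻¹ < 1 := inv_lt_one_of_one_lt₀ hlb
  refine ⟨c * r ^ b / (1 - (lam ^ b)⁻¹), ?_, (lam ^ b)⁻¹, ⟨by positivity, hq⟩, ?_⟩
  · have : 0 < 1 - (lam ^ b)⁻¹ := by linarith
    positivity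
  · intro n x y hy
    have h1 := h.contr n x y hy
    have h2 : dist y x ≤ r * (lam ^ n)⁻¹ := by
      rw [← div_eq_mul_inv, le_div_iff₀ (by positivity), dist_comm]
      linarith
    have h3 : (r * (lam ^ n)⁻¹) ^ b = r ^ b * (lam ^ b)⁻¹ ^ n := by
      rw [Real.mul_rpow hr.le (by positivity), Real.inv_rpow (by positivity), inv_pow,
        ← Real.rpow_natCast, ← Real.rpow_natCast, ← Real.rpow_mul hl0.le, ← Real.rpow_mul hl0.le,
        mul_comm b]
    calc |φ y - φ x| ≤ c * dist y x ^ b := hφ y x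
      _ ≤ c * (r * (lam ^ n)⁻¹) ^ b := by
        gcongr
        exact hb.1.le
      _ = _ := by
        rw [h3, pow_succ]
        have : 1 - (lam ^ b)⁻¹ ≠ 0 := by linarith
        generalize (lam ^ b)⁻¹ = q at *
        field_simp

lemma conf_step {X : Type*} [MetricSpace X] [CompactSpace X] [MeasurableSpace X] [BorelSpace X]
    {f : X → X} {φ : X → ℝ} (hφ : Continuous φ) (m : Measure X) [IsProbabilityMeasure m] {P : ℝ}
    (hconf : ∀ Y : Set X, MeasurableSet Y → Set.InjOn f Y →
      (m (f '' Y)).toReal = Real.exp P * ∫ y in Y, Real.exp (-(φ y)) ∂m)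
    (Y : Set X) (hY : MeasurableSet Y) (hinj : InjOn f Y) (a ε : ℝ)
    (h : ∀ y ∈ Y, |φ y - a| ≤ ε) :
    m.real (f '' Y) ≤ Real.exp (P - a + ε) * m.real Y ∧
    Real.exp (P - a - ε) * m.real Y ≤ m.real (f '' Y) := by
  have hIntg : IntegrableOn (fun y => Real.exp (-(φ y))) Y m :=
    (Continuous.integrable_of_hasCompactSupport (by fun_prop)
      (HasCompactSupport.of_compactSpace _)).integrableOn
  have hc : ∀ c : ℝ, IntegrableOn (fun _ => c) Y m := fun c =>
    integrableOn_const (measure_ne_top _ _)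
  have e := hconf Y hY hinj
  change m.real (f '' Y) = _ at e
  rw [e]
  constructor
  · have : ∫ y in Y, Real.exp (-(φ y)) ∂m ≤ ∫ y in Y, Real.exp (-a + ε) ∂m :=
      setIntegral_mono_on hIntg (hc _) hY fun y hy => by
        have := abs_le.1 (h y hy)
        exact Real.exp_le_exp.2 (by linarith)
    rw [setIntegral_const, smul_eq_mul] at this
    calc _ ≤ Real.exp P * (m.real Y * Real.exp (-a + ε)) := by gcongr
      _ = _ := by
        rw [show P - a + ε = P + (-a + ε) by ring, Real.exp_add P]; ring
  · have : ∫ y in Y, Real.exp (-a - ε) ∂m ≤ ∫ y in Y, Real.exp (-(φ y)) ∂m :=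
      setIntegral_mono_on (hc _) hIntg hY fun y hy => by
        have := abs_le.1 (h y hy)
        exact Real.exp_le_exp.2 (by linarith)
    rw [setIntegral_const, smul_eq_mul] at this
    calc _ = Real.exp P * (m.real Y * Real.exp (-a - ε)) := by
          rw [show P - a - ε = P + (-a - ε) by ring, Real.exp_add P]; ring
      _ ≤ _ := by gcongr

lemma birkhoff_succ {X : Type*} (f : X → X) (φ : X → ℝ) (n : ℕ) (x : X) :
    birkhoffSum' f φ (n + 1) x = φ x + birkhoffSum' f φ n (f x) := by
  simp only [birkhoffSum', Finset.sum_range_succ', Function.iterate_succ_apply,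
    Function.iterate_zero, id]
  ring

lemma LocExp.distort {X : Type*} [MetricSpace X] [CompactSpace X] [MeasurableSpace X]
    [BorelSpace X] {f : X → X} {r lam : ℝ} (h : LocExp f r lam) (hf : Continuous f)
    {φ : X → ℝ} (hφ : HolderPotential φ) (m : Measure X) [IsProbabilityMeasure m] {P : ℝ}
    (hconf : ∀ Y : Set X, MeasurableSet Y → Set.InjOn f Y →
      (m (f '' Y)).toReal = Real.exp P * ∫ y in Y, Real.exp (-(φ y)) ∂m) :
    ∃ T > (0 : ℝ), ∀ n x Y, MeasurableSet Y → Y ⊆ bowenBall f n x r →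
      m.real (f^[n] '' Y) ≤ T * Real.exp (n * P - birkhoffSum' f φ n x) * m.real Y ∧
      m.real Y * Real.exp (n * P - birkhoffSum' f φ n x) ≤ T * m.real (f^[n] '' Y) := by
  obtain ⟨D, hD, q, ⟨hq0, hq1⟩, hosc⟩ := h.holder hφ
  have key : ∀ n x Y, MeasurableSet Y → Y ⊆ bowenBall f n x r →
      m.real (f^[n] '' Y) ≤ Real.exp (n * P - birkhoffSum' f φ n x + D * (q - q ^ (n + 1))) *
        m.real Y ∧
      Real.exp (n * P - birkhoffSum' f φ n x - D * (q - q ^ (n + 1))) * m.real Y ≤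
        m.real (f^[n] '' Y) := by
    intro n
    induction n with
    | zero => intro x Y _ _; simp [birkhoffSum']
    | succ n ih =>
      intro x Y hY hsub
      have hinj : InjOn f Y := h.injOn (x := x) fun y hy => (mem_bowenBall_succ.1 (hsub hy)).1
      have hmeas : MeasurableSet (f '' Y) := hY.image_of_continuousOn_injOn hf.continuousOn hinj
      obtain ⟨i1, i2⟩ := ih (f x) (f '' Y) hmeas (by
        rintro _ ⟨y, hy, rfl⟩
        exact (mem_bowenBall_succ.1 (hsub hy)).2)
      obtain ⟨s1, s2⟩ := conf_step hφ.cont m hconf Y hY hinj (φ x) _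
        fun y hy => hosc (n + 1) x y (hsub hy)
      rw [Function.iterate_succ, image_comp, birkhoff_succ]
      constructor
      · refine i1.trans ((mul_le_mul_of_nonneg_left s1 (Real.exp_pos _).le).trans_eq ?_)
        rw [← mul_assoc, ← Real.exp_add]
        congr 2
        push_cast
        ring
      · refine le_trans (Eq.trans_le ?_ (mul_le_mul_of_nonneg_left s2 (Real.exp_pos _).le)) i2
        rw [← mul_assoc, ← Real.exp_add]
        congr 2
        push_cast
        ring
  refine ⟨Real.exp D, Real.exp_pos _, fun n x Y hY hsub => ?_⟩
  obtain ⟨k1, k2⟩ := key n x Y hY hsub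
  have hle : D * (q - q ^ (n + 1)) ≤ D := by
    have : 0 < q ^ (n + 1) := by positivity
    exact mul_le_of_le_one_right hD (by linarith)
  constructor
  · refine k1.trans ?_
    rw [← Real.exp_add]
    exact mul_le_mul_of_nonneg_right (Real.exp_le_exp.2 (by linarith)) measureReal_nonneg
  · have : m.real Y * Real.exp (n * P - birkhoffSum' f φ n x) ≤
      Real.exp D * (Real.exp (n * P - birkhoffSum' f φ n x - D * (q - q ^ (n + 1))) * m.real Y) := by
      rw [← mul_assoc, ← Real.exp_add, mul_comm]
      gcongr
      linarith
    exact this.trans (by gcongr)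

lemma LocExp.null_image {X : Type*} [MetricSpace X] [CompactSpace X] [MeasurableSpace X]
    [BorelSpace X] {f : X → X} {r lam : ℝ} (h : LocExp f r lam)
    {φ : X → ℝ} (m : Measure X) [IsProbabilityMeasure m] {P : ℝ}
    (hconf : ∀ Y : Set X, MeasurableSet Y → Set.InjOn f Y →
      (m (f '' Y)).toReal = Real.exp P * ∫ y in Y, Real.exp (-(φ y)) ∂m)
    (Z : Set X) (hZ : m Z = 0) (n : ℕ) : m (f^[n] '' Z) = 0 := by
  have step : ∀ Z : Set X, m Z = 0 → m (f '' Z) = 0 := by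
    intro Z hZ
    obtain ⟨t, -, ht, hcov⟩ := (isCompact_univ (X := X)).finite_cover_balls h.rpos
    have hsub : f '' Z ⊆ ⋃ x ∈ t, f '' (toMeasurable m Z ∩ ball x r) := by
      rintro _ ⟨z, hz, rfl⟩
      obtain ⟨x, hx, hzx⟩ := mem_iUnion₂.1 (hcov (mem_univ z))
      exact mem_iUnion₂.2 ⟨x, hx, z, ⟨subset_toMeasurable m Z hz, hzx⟩, rfl⟩
    refine measure_mono_null hsub ((measure_biUnion_null_iff ht.countable).2 fun x _ => ?_)
    have h0 : m (toMeasurable m Z ∩ ball x r) = 0 :=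
      measure_mono_null inter_subset_left (by rw [measure_toMeasurable, hZ])
    have e := hconf (toMeasurable m Z ∩ ball x r)
      ((measurableSet_toMeasurable m Z).inter measurableSet_ball)
      (h.injOn (x := x) fun y hy => by
        rw [dist_comm]; exact hy.2)
    rw [Measure.restrict_eq_zero.2 h0, integral_zero_measure, mul_zero,
      ENNReal.toReal_eq_zero_iff] at e
    exact e.resolve_right (measure_ne_top _ _)
  induction n generalizing Z with
  | zero => simpa using hZ
  | succ n ih =>
    rw [Function.iterate_succ, image_comp]
    exact ih _ (step Z hZ)

lemma LocExp.pos_ball {X : Type*} [MetricSpace X] [CompactSpace X] [Nonempty X]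
    [MeasurableSpace X]
    [BorelSpace X] {f : X → X} {r lam : ℝ} (h : LocExp f r lam)
    (htrans : TopologicallyTransitive f)
    {φ : X → ℝ} (m : Measure X) [IsProbabilityMeasure m] {P : ℝ}
    (hconf : ∀ Y : Set X, MeasurableSet Y → Set.InjOn f Y →
      (m (f '' Y)).toReal = Real.exp P * ∫ y in Y, Real.exp (-(φ y)) ∂m)
    (A : Set X) (hA : ∀ n, f^[n] ⁻¹' A ⊆ A) (hmA : m A ≠ 0) :
    ∃ ε > (0 : ℝ), ∀ z, ε ≤ m.real (ball z (r / 2) ∩ A) := by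
  have hr := h.rpos
  have hpos : ∀ z, 0 < m.real (ball z (r / 4) ∩ A) := by
    intro z
    rw [measureReal_def]
    refine ENNReal.toReal_pos (fun h0 => hmA ?_) (measure_ne_top _ _)
    have hsub : A ⊆ ⋃ n : ℕ, f^[n] '' (ball z (r / 4) ∩ A) := by
      intro x hx
      obtain ⟨n, y, hy, rfl⟩ := h.cover htrans (ball z (r / 4)) isOpen_ball
        ⟨z, mem_ball_self (by positivity)⟩ x
      exact mem_iUnion.2 ⟨n, y, ⟨hy, hA n hx⟩, rfl⟩
    exact measure_mono_null hsub (measure_iUnion_null fun n => h.null_image m hconf _ h0 n)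
  obtain ⟨t, -, ht, hcov⟩ := (isCompact_univ (X := X)).finite_cover_balls
    (show 0 < r / 4 by positivity)
  have htne : t.Nonempty := by
    obtain ⟨x⟩ := ‹Nonempty X›
    obtain ⟨y, hy, -⟩ := mem_iUnion₂.1 (hcov (mem_univ x))
    exact ⟨y, hy⟩
  obtain ⟨x₀, -, hmin⟩ := Set.exists_min_image t (fun z => m.real (ball z (r / 4) ∩ A)) ht htne
  refine ⟨_, hpos x₀, fun z => ?_⟩
  obtain ⟨x, hx, hzx⟩ := mem_iUnion₂.1 (hcov (mem_univ z))
  refine (hmin x hx).trans (measureReal_mono ?_)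
  refine inter_subset_inter_left _ (ball_subset_ball' ?_)
  rw [mem_ball, dist_comm] at hzx
  linarith

lemma LocExp.absContRestrict {X : Type*} [MetricSpace X] [CompactSpace X] [Nonempty X]
    [MeasurableSpace X]
    [BorelSpace X] {f : X → X} {r lam : ℝ} (h : LocExp f r lam) (hf : Continuous f)
    (htrans : TopologicallyTransitive f)
    {φ : X → ℝ} (m : Measure X) [IsProbabilityMeasure m] {P : ℝ}
    (hconf : ∀ Y : Set X, MeasurableSet Y → Set.InjOn f Y →
      (m (f '' Y)).toReal = Real.exp P * ∫ y in Y, Real.exp (-(φ y)) ∂m)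
    (T : ℝ) (hT : 0 < T) (hdist : ∀ n x Y, MeasurableSet Y → Y ⊆ bowenBall f n x r →
      m.real (f^[n] '' Y) ≤ T * Real.exp (n * P - birkhoffSum' f φ n x) * m.real Y)
    (A : Set X) (hAm : MeasurableSet A) (hA : ∀ n, f^[n] ⁻¹' A ⊆ A) (hmA : m A ≠ 0)
    (ν : Measure X) [IsProbabilityMeasure ν] (W : ℝ) (hW : 0 ≤ W)
    (hν : ∀ n x, ν.real (bowenBall f n x r) * Real.exp (n * P - birkhoffSum' f φ n x) ≤ W) :
    ν ≪ m.restrict A := by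
  have hr := h.rpos
  obtain ⟨ε, hε, hball⟩ := h.pos_ball htrans m hconf A hA hmA
  refine h.absCont hf ν (m.restrict A) (ENNReal.ofReal (W * T / ε)) ENNReal.ofReal_ne_top ?_
  intro n x
  set E := Real.exp (n * P - birkhoffSum' f φ n x)
  have hE : 0 < E := Real.exp_pos _
  set B := bowenBall f n x (r / 2)
  have hB : MeasurableSet B := (isOpen_bowenBall hf n x _).measurableSet
  have h1 : ε ≤ T * E * m.real (B ∩ A) := by
    calc ε ≤ m.real (ball (f^[n] x) (r / 2) ∩ A) := hball _
      _ ≤ m.real (f^[n] '' (B ∩ A)) := by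
        refine measureReal_mono ?_
        rintro w ⟨hw, hwA⟩
        obtain ⟨y, hy, rfl⟩ := h.image (by linarith) n x hw
        exact ⟨y, ⟨hy, hA n hwA⟩, rfl⟩
      _ ≤ _ := hdist n x _ (hB.inter hAm)
        (inter_subset_left.trans (bowenBall_mono f n x (by linarith)))
  have h2 : ν.real (bowenBall f n x r) ≤ W * T / ε * m.real (B ∩ A) := by
    have h3 := hν n x
    have h4 : ν.real (bowenBall f n x r) ≤ W / E := by rwa [le_div_iff₀ hE]
    refine h4.trans ?_
    rw [div_le_iff₀ hE]
    calc W = W / ε * ε := by field_simp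
      _ ≤ W / ε * (T * E * m.real (B ∩ A)) := by gcongr
      _ = _ := by ring
  rw [Measure.restrict_apply hB, ← ofReal_measureReal, ← ofReal_measureReal,
    ← ENNReal.ofReal_mul (by positivity)]
  exact ENNReal.ofReal_le_ofReal h2

/-- **Equivalence of the Gibbs measure and the conformal measure.** If `μ` is an
`f`-invariant probability measure with the Gibbs property for `φ` (constants
`C ∈ (0,1]`, `P`, `r₀ > 0`) and `m` is a `φ`-conformal probability measure with
parameter `lam = e^P`, then `μ ≪ m` and `m ≪ μ`. -/
theorem gibbs_equivalent_conformal {X : Type*} [MetricSpace X] [CompactSpace X]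
    [Nonempty X] [MeasurableSpace X] [BorelSpace X]
    (f : X → X) (φ : X → ℝ) (hf : Continuous f) (hopen : IsOpenMap f)
    (hexp : DistanceExpanding f) (htrans : TopologicallyTransitive f)
    (hφ : HolderPotential φ)
    (μ m : Measure X) (hμ : IsProbabilityMeasure μ) (hm : IsProbabilityMeasure m)
    (hinv : ∀ E : Set X, MeasurableSet E → μ (f ⁻¹' E) = μ E)
    (C P r₀ : ℝ) (hC : C ∈ Set.Ioc (0 : ℝ) 1) (hr₀ : 0 < r₀)
    (hGibbs : ∀ x : X, ∀ n : ℕ,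
      C ≤ (μ (bowenBall f n x r₀)).toReal * Real.exp (n * P - birkhoffSum' f φ n x) ∧
      (μ (bowenBall f n x r₀)).toReal * Real.exp (n * P - birkhoffSum' f φ n x) ≤ C⁻¹)
    (hconf : ∀ Y : Set X, MeasurableSet Y → Set.InjOn f Y →
      (m (f '' Y)).toReal = Real.exp P * ∫ y in Y, Real.exp (-(φ y)) ∂m) :
    μ ≪ m ∧ m ≪ μ := by
  obtain ⟨r, lam, h, hr⟩ := exists_locExp f hf hopen hexp r₀ hr₀
  obtain ⟨T, hT, hdist⟩ := h.distort hf hφ m hconf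
  have hdist1 := fun n x Y hY hs => (hdist n x Y hY hs).1
  have hC0 : 0 < C := hC.1
  have hμm : μ ≪ m := by
    have := h.absContRestrict hf htrans m hconf T hT hdist1 univ MeasurableSet.univ (by simp) (by simp) μ
      C⁻¹ (by positivity) (fun n x => by
        refine le_trans ?_ (hGibbs x n).2
        refine mul_le_mul_of_nonneg_right ?_ (Real.exp_pos _).le
        exact measureReal_mono (bowenBall_mono f n x hr))
    rwa [Measure.restrict_univ] at this
  refine ⟨hμm, Measure.AbsolutelyContinuous.mk fun E hE hμE => ?_⟩
  set A : Set X := ⋃ n : ℕ, f^[n] ⁻¹' E with hAdef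
  have hpre : ∀ n : ℕ, μ (f^[n] ⁻¹' E) = 0 := by
    intro n
    induction n with
    | zero => simpa using hμE
    | succ n ih =>
      rw [Function.iterate_succ, preimage_comp, hinv _ ((hf.iterate n).measurable hE)]
      exact ih
  have hμA : μ A = 0 := measure_iUnion_null hpre
  have hAm : MeasurableSet A := MeasurableSet.iUnion fun n => (hf.iterate n).measurable hE
  have hA : ∀ n, f^[n] ⁻¹' A ⊆ A := by
    intro n x hx
    obtain ⟨k, hk⟩ := mem_iUnion.1 hx
    refine mem_iUnion.2 ⟨k + n, ?_⟩
    rw [mem_preimage, Function.iterate_add_apply]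
    exact hk
  have hEA : E ⊆ A := fun x hx => mem_iUnion.2 ⟨0, hx⟩
  by_contra hne
  have hmA : m A ≠ 0 := fun h0 => hne (measure_mono_null hEA h0)
  have hac := h.absContRestrict hf htrans m hconf T hT hdist1 A hAm hA hmA m T hT.le (fun n x => by
    refine ((hdist n x _ (isOpen_bowenBall hf n x r).measurableSet subset_rfl).2).trans ?_
    exact mul_le_of_le_one_right hT.le measureReal_le_one)
  have h1 : m Aᶜ = 0 := hac (by rw [Measure.restrict_apply hAm.compl]; simp)
  have h2 : μ Aᶜ = 0 := hμm h1
  have h3 : μ univ = 0 := by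
    rw [← union_compl_self A]
    exact measure_union_null hμA h2
  simp at h3
end
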